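/- arXiv:1611.04225 — 9 statements merged into one kernel-verified Lean document; each statement's English description precedes it below -/
import Mathlib

section
/- If a binary phylogenetic network N on X is tree-based, then N has an antichain A contained in its vertex set V and a partition Π of V into |A| blocks, each of which is the vertex set of a directed path in N ending at a leaf in X. -/
open Finset

/-- Raw data of a directed network on vertex type `V`: a finite edge set
    (so there are no parallel edges), a distinguished vertex subset `X`
    (the intended leaf set), and a root vertex. -/
structure Network (V : Type) where
  E : Finset (V × V)
  X : Finset V
  root : V

variable {V : Type} [Fintype V] [DecidableEq V]

/-- Adjacency relation of the digraph with edge set `E`. -/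
def adjOf (E : Finset (V × V)) : V → V → Prop := fun a b => (a, b) ∈ E

/-- In-degree of a vertex. -/
def inDeg (E : Finset (V × V)) (v : V) : ℕ := (E.filter fun e => e.2 = v).card

/-- Out-degree of a vertex. -/
def outDeg (E : Finset (V × V)) (v : V) : ℕ := (E.filter fun e => e.1 = v).card

/-- `N` is a (binary) phylogenetic network on `N.X`: a rooted acyclic digraph with
    no parallel edges in which the unique root has in-degree 0 and out-degree 2,
    the set of out-degree-0 vertices (the leaves) is exactly `X` (each such vertex
    having in-degree 1), and every other non-root vertex has in-degree 1 and
    out-degree 2, or in-degree 2 and out-degree 1; if `|X| = 1` the network may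
    instead consist of a single vertex. -/
def IsPhyloNetwork (N : Network V) : Prop :=
  N.X.Nonempty ∧
  (∀ v : V, ¬ Relation.TransGen (adjOf N.E) v v) ∧
  inDeg N.E N.root = 0 ∧
  (∀ v : V, Relation.ReflTransGen (adjOf N.E) N.root v) ∧
  N.X = Finset.univ.filter (fun v => outDeg N.E v = 0) ∧
  (Fintype.card V = 1 ∨
    (outDeg N.E N.root = 2 ∧
      ∀ v : V, v ≠ N.root →
        (inDeg N.E v = 1 ∧ outDeg N.E v = 0) ∨
        (inDeg N.E v = 1 ∧ outDeg N.E v = 2) ∨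
        (inDeg N.E v = 2 ∧ outDeg N.E v = 1)))

/-- A (nonempty) directed path in the digraph with edge set `E`, recorded as its
    list of vertices (consecutive vertices joined by an edge, no repeated vertex). -/
def IsDirPath (E : Finset (V × V)) (p : List V) : Prop :=
  p ≠ [] ∧ List.Chain' (adjOf E) p ∧ p.Nodup

/-- The path `p` ends at a vertex belonging to `S`. -/
def EndsIn (S : Finset V) (p : List V) : Prop := ∃ x ∈ S, p.getLast? = some x

/-- `(V, E')` is a rooted spanning tree with root `r`, all edges directed away
    from `r`: `r` has in-degree 0, every other vertex has in-degree 1, and every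
    vertex is reachable from `r`. -/
def IsArborescence (E' : Finset (V × V)) (r : V) : Prop :=
  inDeg E' r = 0 ∧ (∀ v : V, v ≠ r → inDeg E' v = 1) ∧
  ∀ v : V, Relation.ReflTransGen (adjOf E') r v

/-- `N` is tree-based: it has a rooted spanning tree `(V, E')` with `E' ⊆ E`
    all of whose leaves (out-degree-0 vertices) lie in `X`. -/
def TreeBased (N : Network V) : Prop :=
  ∃ (E' : Finset (V × V)) (r : V),
    E' ⊆ N.E ∧ IsArborescence E' r ∧ ∀ v : V, outDeg E' v = 0 → v ∈ N.X

/-- `S` is an antichain in the digraph with edge set `E`: for all distinct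
    `u, v ∈ S` there is no directed path from `u` to `v`. -/
def IsDigraphAntichain (E : Finset (V × V)) (S : Finset V) : Prop :=
  ∀ u ∈ S, ∀ v ∈ S, u ≠ v → ¬ Relation.ReflTransGen (adjOf E) u v

/-- The paths in `P` are pairwise vertex-disjoint. -/
def PairwiseDisjointPaths (P : Finset (List V)) : Prop :=
  ∀ p ∈ P, ∀ q ∈ P, p ≠ q → ∀ v : V, v ∈ p → v ∉ q

/-- Property (II): `N` has an antichain `A` and a partition of the vertex set into
    `|A|` blocks, each of which is the vertex set of a directed path in `N` ending
    at a leaf in `X`. -/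
def AntichainPartition (N : Network V) : Prop :=
  ∃ (A : Finset V) (P : Finset (List V)),
    IsDigraphAntichain N.E A ∧ P.card = A.card ∧
    (∀ p ∈ P, IsDirPath N.E p ∧ EndsIn N.X p) ∧
    ∀ v : V, ∃! p, p ∈ P ∧ v ∈ p

/-- There is a set of pairwise vertex-disjoint directed paths in `N`, each ending
    at a leaf in `X`, such that each element of `U` lies on exactly one path. -/
def CoversExactly (N : Network V) (U : Finset V) : Prop :=
  ∃ P : Finset (List V),
    (∀ p ∈ P, IsDirPath N.E p ∧ EndsIn N.X p) ∧
    PairwiseDisjointPaths P ∧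
    ∀ u ∈ U, ∃! p, p ∈ P ∧ u ∈ p

/-- Property (V): the vertex set of `N` can be partitioned into vertex sets of
    pairwise vertex-disjoint directed paths, each ending at a leaf in `X`. -/
def PathPartitionProp (N : Network V) : Prop :=
  ∃ P : Finset (List V),
    (∀ p ∈ P, IsDirPath N.E p ∧ EndsIn N.X p) ∧
    ∀ v : V, ∃! p, p ∈ P ∧ v ∈ p

/-- `p` is a directed path from `u` to `v`. -/
def PathFromTo (E : Finset (V × V)) (p : List V) (u v : V) : Prop :=
  IsDirPath E p ∧ p.head? = some u ∧ p.getLast? = some v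

/-- The pair `(U₁, U₂)` witnesses the failure of property (IV): `|U₁| > |U₂|`,
    (i) every directed path from a vertex of `U₁` to a vertex of `X` traverses a
    vertex of `U₂`, and (ii) for `{i,j} = {1,2}`, every directed path from a vertex
    of `Uᵢ` to another vertex of `Uᵢ` traverses a vertex of `Uⱼ`. -/
def BadPair (N : Network V) (U₁ U₂ : Finset V) : Prop :=
  U₂.card < U₁.card ∧
  (∀ (p : List V) (u x : V), u ∈ U₁ → x ∈ N.X → PathFromTo N.E p u x →
    ∃ w ∈ U₂, w ∈ p) ∧
  (∀ (p : List V) (u v : V), u ∈ U₁ → v ∈ U₁ → u ≠ v → PathFromTo N.E p u v →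
    ∃ w ∈ U₂, w ∈ p) ∧
  (∀ (p : List V) (u v : V), u ∈ U₂ → v ∈ U₂ → u ≠ v → PathFromTo N.E p u v →
    ∃ w ∈ U₁, w ∈ p)

/-- `M` is a matching of the bipartite graph `G_N` associated with the edge set `E`
    (vertex classes two disjoint copies `V₁, V₂` of `V`, with `u ∈ V₁` joined to
    `v ∈ V₂` exactly when `(u,v) ∈ E`): a set of edges of `G_N`, no two of which
    share an endpoint. -/
def IsMatching (E M : Finset (V × V)) : Prop :=
  M ⊆ E ∧ ∀ e ∈ M, ∀ f ∈ M, e ≠ f → e.1 ≠ f.1 ∧ e.2 ≠ f.2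

/-- `N` is temporal: there is `λ : V → ℝ` with `λ u = λ v` for every reticulation
    edge `(u,v)` (an edge into an in-degree-2 vertex) and `λ u < λ v` for every
    other (tree) edge `(u,v)`. -/
def IsTemporal (N : Network V) : Prop :=
  ∃ lam : V → ℝ, ∀ e ∈ N.E,
    (inDeg N.E e.2 = 2 → lam e.1 = lam e.2) ∧
    (inDeg N.E e.2 ≠ 2 → lam e.1 < lam e.2)

/-- `N` satisfies the antichain-to-leaf property: for every antichain `S` of `N`
    there exist `|S|` pairwise vertex-disjoint directed paths from the elements of
    `S` to leaves of `N`. -/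
def AntichainToLeaf (N : Network V) : Prop :=
  ∀ S : Finset V, IsDigraphAntichain N.E S →
    ∃ P : Finset (List V), P.card = S.card ∧
      (∀ p ∈ P, IsDirPath N.E p ∧ EndsIn N.X p) ∧
      PairwiseDisjointPaths P ∧
      ∀ s ∈ S, ∃ p ∈ P, p.head? = some s

/-- `(V, E)` with root `r` is (up to the intrinsic degree characterisation) a
    subdivision of a rooted binary tree: a rooted tree, all edges directed away
    from the root, with every out-degree at most 2 and (unless it is a single
    vertex) root of out-degree exactly 2 — precisely the graphs obtained from a
    rooted binary tree by repeatedly subdividing edges. -/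
def IsSubdividedRootedBinaryTree (E : Finset (V × V)) (r : V) : Prop :=
  IsArborescence E r ∧ (∀ v : V, outDeg E v ≤ 2) ∧
  (Fintype.card V = 1 ∨ outDeg E r = 2)

/-- `d(N)`: the smallest number of pairwise vertex-disjoint directed paths whose
    vertex sets partition the vertex set of `N`. -/
noncomputable def dN (N : Network V) : ℕ :=
  sInf {k | ∃ P : Finset (List V), P.card = k ∧ (∀ p ∈ P, IsDirPath N.E p) ∧
    ∀ v : V, ∃! p, p ∈ P ∧ v ∈ p}

/-- `p(N) = d(N) - |X|`. -/
noncomputable def pN (N : Network V) : ℕ := dN N - N.X.card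

/-- The size of a maximum-sized matching of the bipartite graph `G_N`. -/
noncomputable def maxMatchingCard (E : Finset (V × V)) : ℕ :=
  sSup {k | ∃ M : Finset (V × V), IsMatching E M ∧ M.card = k}

/-- `u(G_N)`: the number of vertices of the copy `V₁` of `V` left unmatched by a
    maximum-sized matching of `G_N`. -/
noncomputable def uGN (N : Network V) : ℕ := Fintype.card V - maxMatchingCard N.E

/-- `l(N)`: the minimum, over all rooted spanning trees of `N`, of the number of
    leaves of the spanning tree lying outside `X`. -/
noncomputable def lN (N : Network V) : ℕ :=
  sInf {k | ∃ (E' : Finset (V × V)) (r : V), E' ⊆ N.E ∧ IsArborescence E' r ∧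
    (Finset.univ.filter fun v => outDeg E' v = 0 ∧ v ∉ N.X).card = k}

/-- The network obtained from `N` by attaching a new leaf to the edge `e`:
    `e` is subdivided by the new vertex `Sum.inr 0`, and the new leaf `Sum.inr 1`
    is made a child of `Sum.inr 0` and added to `X`. -/
def attachLeaf (N : Network V) (e : V × V) : Network (V ⊕ Fin 2) where
  E := ((N.E.erase e).image fun f => (Sum.inl f.1, Sum.inl f.2)) ∪
    {(Sum.inl e.1, Sum.inr 0), (Sum.inr 0, Sum.inl e.2), (Sum.inr 0, Sum.inr 1)}
  X := N.X.image Sum.inl ∪ {Sum.inr 1}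
  root := Sum.inl N.root

/-- `CanMakeTreeBased k N`: one can attach `k` new leaves to `N`, one after the
    other (each to an edge of the current network), so that the resulting network
    is tree-based. -/
def CanMakeTreeBased : ℕ → {V : Type} → [Fintype V] → [DecidableEq V] →
    Network V → Prop
  | 0, _, _, _, N => TreeBased N
  | k + 1, _, _, _, N => ∃ e ∈ N.E, CanMakeTreeBased k (attachLeaf N e)

/-- `t(N)`: the minimum number of leaves that must be attached to `N` so that the
    resulting network is tree-based. -/
noncomputable def tN (N : Network V) : ℕ := sInf {k | CanMakeTreeBased k N}

/-- The network obtained from `N` by simultaneously attaching one new leaf to each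
    edge in `F`: each `f ∈ F` is subdivided by the new vertex `Sum.inr (f, 0)`,
    which also gets the new leaf `Sum.inr (f, 1)` as a child. -/
def attachAll (N : Network V) (F : Finset (V × V)) :
    Network (V ⊕ ((V × V) × Fin 2)) where
  E := ((N.E \ F).image fun f => (Sum.inl f.1, Sum.inl f.2)) ∪
    (F.image fun f => (Sum.inl f.1, Sum.inr (f, 0))) ∪
    (F.image fun f => (Sum.inr (f, 0), Sum.inl f.2)) ∪
    (F.image fun f => (Sum.inr (f, 0), Sum.inr (f, 1)))
  X := N.X.image Sum.inl ∪ F.image fun f => Sum.inr (f, 1)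
  root := Sum.inl N.root

/-- If a binary phylogenetic network `N` on `X` is tree-based, then
`N` has an antichain `A ⊆ V` and a partition of `V` into `|A|` blocks, each of
which is the vertex set of a directed path in `N` ending at a leaf in `X`. -/
theorem stmt_0 {V : Type} [Fintype V] [DecidableEq V] (N : Network V)
    (hN : IsPhyloNetwork N) (h : TreeBased N) :
    ∃ (A : Finset V) (P : Finset (List V)),
      IsDigraphAntichain N.E A ∧ P.card = A.card ∧
      (∀ p ∈ P, IsDirPath N.E p ∧ EndsIn N.X p) ∧
      ∀ v : V, ∃! p, p ∈ P ∧ v ∈ p := by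
  obtain ⟨-, hac, -, -, hX, -⟩ := hN
  obtain ⟨E', r, hE, ⟨hr, hin, -⟩, hleaf⟩ := h
  have hXout : ∀ x ∈ N.X, ∀ y, ¬ adjOf N.E x y := by
    intro x hx y hxy
    rw [hX, Finset.mem_filter] at hx
    have h0 := hx.2
    unfold outDeg at h0
    rw [Finset.card_eq_zero] at h0
    have : (x, y) ∈ N.E.filter (fun e => e.1 = x) := Finset.mem_filter.2 ⟨hxy, rfl⟩
    rw [h0] at this
    simp at this
  have hc : ∀ v, v ∉ N.X → ∃ u, (v, u) ∈ E' := by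
    intro v hv
    have h1 : outDeg E' v ≠ 0 := fun h0 => hv (hleaf v h0)
    unfold outDeg at h1
    obtain ⟨⟨a, b⟩, he⟩ := Finset.card_ne_zero.1 h1
    obtain ⟨he1, he2⟩ := Finset.mem_filter.1 he
    simp only at he2
    subst he2
    exact ⟨b, he1⟩
  have hinj : ∀ a b v, (a, v) ∈ E' → (b, v) ∈ E' → a = b := by
    intro a b v ha hb
    have h1 : inDeg E' v ≤ 1 := by
      by_cases hv : v = r
      · rw [hv, hr]; omega
      · rw [hin v hv]
    unfold inDeg at h1
    have := Finset.card_le_one.1 h1 (a, v) (Finset.mem_filter.2 ⟨ha, rfl⟩) (b, v)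
      (Finset.mem_filter.2 ⟨hb, rfl⟩)
    exact congrArg Prod.fst this
  choose c hcE using hc
  let M : V → V → Prop := fun u v => ∃ h : u ∉ N.X, c u h = v
  have hME' : ∀ u v, M u v → (u, v) ∈ E' := by
    rintro u v ⟨h, rfl⟩
    exact hcE u h
  have hME : ∀ u v, M u v → adjOf N.E u v := fun u v h => hE (hME' u v h)
  have hML : ∀ a b v, M a v → M b v → a = b := fun a b v ha hb =>
    hinj a b v (hME' _ _ ha) (hME' _ _ hb)
  have hMR : Relator.RightUnique M := by
    rintro a u v ⟨h, rfl⟩ ⟨h', rfl⟩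
    rfl
  have hMX : ∀ x ∈ N.X, ∀ y, Relation.ReflTransGen M x y → x = y := by
    intro x hx y hxy
    rcases Relation.ReflTransGen.cases_head hxy with h | ⟨z, ⟨h, -⟩, -⟩
    · exact h
    · exact absurd hx h
  have : IsTrans V (Relation.TransGen (adjOf N.E)) := ⟨fun _ _ _ => Relation.TransGen.trans⟩
  have : Std.Irrefl (Relation.TransGen (adjOf N.E)) := ⟨hac⟩
  have hwf : WellFounded (Relation.TransGen (adjOf N.E)) :=
    Finite.wellFounded_of_trans_of_irrefl _
  have hwf' : WellFounded (Function.swap (Relation.TransGen (adjOf N.E))) := by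
    have : IsTrans V (Function.swap (Relation.TransGen (adjOf N.E))) :=
      ⟨fun _ _ _ h1 h2 => Relation.TransGen.trans h2 h1⟩
    have : Std.Irrefl (Function.swap (Relation.TransGen (adjOf N.E))) := ⟨hac⟩
    exact Finite.wellFounded_of_trans_of_irrefl _
  have hpath : ∀ v, ∃ p : List V, p.IsChain M ∧ p.getLast? = some v ∧
      ∀ w, w ∈ p ↔ Relation.ReflTransGen M w v := by
    intro v
    induction v using hwf.induction with
    | _ v ih =>
      by_cases hv : ∃ u, M u v
      · obtain ⟨u, hu⟩ := hv
        obtain ⟨p, hp1, hp2, hp3⟩ := ih u (.single (hME _ _ hu))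
        refine ⟨p ++ [v], ?_, by simp, ?_⟩
        · rw [List.isChain_append]
          refine ⟨hp1, List.isChain_singleton _, ?_⟩
          intro x hx y hy
          rw [hp2] at hx
          simp at hx hy
          subst hx hy
          exact hu
        · intro w
          rw [List.mem_append, hp3, List.mem_singleton]
          constructor
          · rintro (h | rfl)
            · exact h.tail hu
            · exact .refl
          · intro h
            rcases Relation.ReflTransGen.cases_tail h with h | ⟨z, h, hz⟩
            · exact Or.inr h.symm
            · rw [hML _ _ _ hz hu] at h
              exact Or.inl h
      · refine ⟨[v], List.isChain_singleton _, by simp, ?_⟩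
        intro w
        rw [List.mem_singleton]
        constructor
        · rintro rfl
          exact .refl
        · intro h
          rcases Relation.ReflTransGen.cases_tail h with h | ⟨z, h, hz⟩
          · exact h.symm
          · exact absurd ⟨z, hz⟩ hv
  choose path hp1 hp2 hp3 using hpath
  have hreach : ∀ v, ∃ x ∈ N.X, Relation.ReflTransGen M v x := by
    intro v
    induction v using hwf'.induction with
    | _ v ih =>
      by_cases hv : v ∈ N.X
      · exact ⟨v, hv, .refl⟩
      · have hm : M v (c v hv) := ⟨hv, rfl⟩
        obtain ⟨x, hx, hr⟩ := ih (c v hv) (.single (hME _ _ hm))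
        exact ⟨x, hx, .head hm hr⟩
  refine ⟨N.X, N.X.image path, ?_, ?_, ?_, ?_⟩
  · intro u hu v hv huv hr
    rcases Relation.ReflTransGen.cases_head hr with h | ⟨z, h, -⟩
    · exact huv h
    · exact hXout u hu z h
  · apply Finset.card_image_of_injective
    intro a b hab
    have := hp2 a
    rw [hab, hp2 b] at this
    exact (Option.some.inj this).symm
  · intro p hp
    obtain ⟨x, hx, rfl⟩ := Finset.mem_image.1 hp
    have hch : (path x).IsChain (adjOf N.E) := (hp1 x).imp hME
    refine ⟨⟨?_, hch, ?_⟩, x, hx, hp2 x⟩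
    · intro h0
      have := hp2 x
      rw [h0] at this
      simp at this
    · have h1 : (path x).IsChain (Relation.TransGen (adjOf N.E)) :=
        hch.imp fun _ _ h => .single h
      have h2 := List.isChain_iff_pairwise.1 h1
      refine List.Pairwise.imp ?_ h2
      rintro a b hab rfl
      exact hac _ hab
  · intro v
    obtain ⟨x, hx, hr⟩ := hreach v
    refine ⟨path x, ⟨Finset.mem_image_of_mem _ hx, (hp3 x v).2 hr⟩, ?_⟩
    rintro q ⟨hq, hvq⟩
    obtain ⟨y, hy, rfl⟩ := Finset.mem_image.1 hq
    have hr' := (hp3 y v).1 hvq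
    rcases Relation.ReflTransGen.total_of_right_unique hMR hr hr' with h | h
    · rw [hMX x hx y h]
    · rw [hMX y hy x h]
end

section
/- Let N = (V,E) be a binary phylogenetic network on X. Suppose there is no pair of subsets U1, U2 ⊆ V with |U1| > |U2| such that (i) every directed path from a vertex in U1 to a vertex in X traverses a vertex in U2, and (ii) for {i,j} = {1,2}, every directed path from a vertex in Ui to a vertex in Ui traverses a vertex in Uj. Then N is tree-based. -/
open Finset

variable {V : Type} [Fintype V] [DecidableEq V]

theorem tb_of_matching (N : Network V) (hN : IsPhyloNetwork N)
    (f : {v : V // v ∉ N.X} → V) (hf : Function.Injective f)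
    (hfE : ∀ v : {v : V // v ∉ N.X}, ((v : V), f v) ∈ N.E) : TreeBased N := by
  classical
  obtain ⟨-, hac, hr, hreach, -, -⟩ := hN
  have hroot : ∀ a, (a, N.root) ∉ N.E := by
    intro a ha
    unfold inDeg at hr
    rw [Finset.card_eq_zero] at hr
    have : (a, N.root) ∈ N.E.filter fun e => e.2 = N.root := by simp [ha]
    rw [hr] at this
    simp at this
  have hpar : ∀ v, v ≠ N.root → ∃ u, (u, v) ∈ N.E ∧ ∀ w, f w = v → (w : V) = u := by
    intro v hv
    by_cases hw : ∃ w, f w = v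
    · obtain ⟨w, rfl⟩ := hw
      exact ⟨w, hfE w, fun w' h => by rw [hf h]⟩
    · push Not at hw
      rcases Relation.ReflTransGen.cases_tail (hreach v) with h | ⟨u, -, hu⟩
      · exact absurd h hv
      · exact ⟨u, hu, fun w h => absurd h (hw w)⟩
  choose! par hpE hpf using hpar
  let E' : Finset (V × V) := (Finset.univ.filter fun v => v ≠ N.root).image fun v => (par v, v)
  have hmem : ∀ a b, (a, b) ∈ E' ↔ b ≠ N.root ∧ par b = a := by
    intro a b
    simp only [E', Finset.mem_image, Finset.mem_filter, Finset.mem_univ, true_and, Prod.mk.injEq]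
    constructor
    · rintro ⟨v, h1, h2, rfl⟩; exact ⟨h1, h2⟩
    · rintro ⟨h1, h2⟩; exact ⟨b, h1, h2, rfl⟩
  refine ⟨E', N.root, ?_, ⟨?_, ?_, ?_⟩, ?_⟩
  · rintro ⟨a, b⟩ h
    obtain ⟨h1, rfl⟩ := (hmem a b).1 h
    exact hpE b h1
  · unfold inDeg
    rw [Finset.card_eq_zero, Finset.filter_eq_empty_iff]
    rintro ⟨a, b⟩ h hb
    exact ((hmem a b).1 h).1 hb
  · intro v hv
    unfold inDeg
    rw [Finset.card_eq_one]
    refine ⟨(par v, v), ?_⟩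
    ext ⟨a, b⟩
    simp only [Finset.mem_filter, hmem, Finset.mem_singleton, Prod.mk.injEq]
    constructor
    · rintro ⟨⟨-, h⟩, rfl⟩; exact ⟨h.symm, rfl⟩
    · rintro ⟨rfl, rfl⟩; exact ⟨⟨hv, rfl⟩, rfl⟩
  · have hwf : WellFounded (Relation.TransGen (adjOf N.E)) := by
      have : Std.Irrefl (Relation.TransGen (adjOf N.E)) := ⟨hac⟩
      exact Finite.wellFounded_of_trans_of_irrefl _
    intro v
    induction v using hwf.induction with
    | _ v ih =>
      by_cases hv : v = N.root
      · subst hv; exact .refl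
      · exact (ih (par v) (.single (hpE v hv))).tail ((hmem _ _).2 ⟨hv, rfl⟩)
  · intro v hv
    by_contra hx
    unfold outDeg at hv
    rw [Finset.card_eq_zero, Finset.filter_eq_empty_iff] at hv
    have hne : f ⟨v, hx⟩ ≠ N.root := fun h => hroot v (h ▸ hfE ⟨v, hx⟩)
    exact hv ((hmem v (f ⟨v, hx⟩)).2 ⟨hne, (hpf _ hne ⟨v, hx⟩ rfl).symm⟩) rfl

theorem path_second (E : Finset (V × V)) (p : List V) (u v : V) (huv : u ≠ v)
    (hp : PathFromTo E p u v) : ∃ w ∈ p, (u, w) ∈ E := by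
  obtain ⟨⟨-, hc, -⟩, h1, h2⟩ := hp
  match p, hc, h1, h2 with
  | [a], _, h1, h2 => simp at h1 h2; exact absurd (h1.symm.trans h2) huv
  | a :: b :: l, hc, h1, h2 =>
    simp at h1
    subst h1
    exact ⟨b, by simp, (List.isChain_cons_cons.1 hc).1⟩

theorem path_penult (E : Finset (V × V)) (p : List V) (u v : V) (huv : u ≠ v)
    (hp : PathFromTo E p u v) : ∃ w ∈ p, (w, v) ∈ E := by
  obtain ⟨⟨-, hc, -⟩, h1, h2⟩ := hp
  change List.IsChain _ p at hc
  induction p generalizing u with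
  | nil => simp at h1
  | cons a l ih =>
    simp at h1
    subst h1
    match l, hc, h2, ih with
    | [], _, h2, _ => simp at h2; exact absurd h2 huv
    | b :: l, hc, h2, ih =>
      by_cases hb : b = v
      · subst hb
        exact ⟨a, by simp, (List.isChain_cons_cons.1 hc).1⟩
      · obtain ⟨w, hw, hE⟩ := ih b hb (by simp) (by simpa using h2) (List.isChain_cons_cons.1 hc).2
        exact ⟨w, by simp [hw], hE⟩

theorem bad_of_hall (N : Network V) (hN : IsPhyloNetwork N) (S : Finset V)
    (hS : ∀ s ∈ S, s ∉ N.X)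
    (hc : (S.biUnion fun s => Finset.univ.filter fun w => (s, w) ∈ N.E).card < S.card) :
    ∃ U₁ U₂ : Finset V, BadPair N U₁ U₂ := by
  classical
  induction S using Finset.strongInduction with
  | _ S ih =>
  set C := S.biUnion fun s => Finset.univ.filter fun w => (s, w) ∈ N.E with hC
  have hCm : ∀ s w, s ∈ S → (s, w) ∈ N.E → w ∈ C := by
    intro s w hs hw
    simp only [hC, Finset.mem_biUnion, Finset.mem_filter, Finset.mem_univ, true_and]
    exact ⟨s, hs, hw⟩
  by_cases hgood : ∀ c ∈ C, ∀ a, (a, c) ∈ N.E → a ∈ S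
  · refine ⟨S, C, hc, ?_, ?_, ?_⟩
    · intro p u x hu hx hp
      obtain ⟨w, hw, hE⟩ := path_second N.E p u x (fun h => hS u hu (h ▸ hx)) hp
      exact ⟨w, hCm u w hu hE, hw⟩
    · intro p u x hu hx hne hp
      obtain ⟨w, hw, hE⟩ := path_second N.E p u x hne hp
      exact ⟨w, hCm u w hu hE, hw⟩
    · intro p u v hu hv hne hp
      obtain ⟨w, hw, hE⟩ := path_penult N.E p u v hne hp
      exact ⟨w, hgood v hv w hE, hw⟩
  · push Not at hgood
    obtain ⟨c, hcC, a, haE, haS⟩ := hgood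
    have hcC' := hcC
    simp only [hC, Finset.mem_biUnion, Finset.mem_filter, Finset.mem_univ, true_and] at hcC'
    obtain ⟨s, hs, hsE⟩ := hcC'
    have hin : inDeg N.E c ≤ 2 := by
      obtain ⟨-, hac, hr, -, -, h1 | ⟨-, h2⟩⟩ := hN
      · exfalso
        have := Fintype.card_le_one_iff.1 h1.le a c
        subst this
        exact hac a (.single haE)
      · by_cases hroot : c = N.root
        · rw [hroot, hr]; omega
        · rcases h2 c hroot with h | h | h <;> omega
    have huniq : ∀ t ∈ S, (t, c) ∈ N.E → t = s := by
      intro t ht htE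
      by_contra hne
      have h3 : ({(a, c), (s, c), (t, c)} : Finset (V × V)).card = 3 := by
        rw [Finset.card_eq_three]
        refine ⟨_, _, _, ?_, ?_, ?_, rfl⟩
        · rintro ⟨⟩; exact haS hs
        · rintro ⟨⟩; exact haS ht
        · rintro ⟨⟩; exact hne rfl
      have hsub : ({(a, c), (s, c), (t, c)} : Finset (V × V)) ⊆
          N.E.filter fun e => e.2 = c := by
        intro e he
        simp only [Finset.mem_insert, Finset.mem_singleton] at he
        rcases he with rfl | rfl | rfl <;> simp [haE, hsE, htE]
      have := Finset.card_le_card hsub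
      unfold inDeg at hin
      omega
    refine ih (S.erase s) (Finset.erase_ssubset hs)
      (fun x hx => hS x (Finset.mem_of_mem_erase hx)) ?_
    have hsub : ((S.erase s).biUnion fun s => Finset.univ.filter fun w => (s, w) ∈ N.E) ⊆
        C.erase c := by
      intro w hw
      simp only [Finset.mem_biUnion, Finset.mem_filter, Finset.mem_univ, true_and,
        Finset.mem_erase] at hw ⊢
      obtain ⟨t, ⟨hts, ht⟩, htE⟩ := hw
      refine ⟨?_, hCm t w ht htE⟩
      rintro rfl
      exact hts (huniq t ht htE)
    have h1 := Finset.card_le_card hsub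
    rw [Finset.card_erase_of_mem hcC] at h1
    rw [Finset.card_erase_of_mem hs]
    have : 0 < C.card := Finset.card_pos.2 ⟨c, hcC⟩
    omega

/-- If there is no pair `U₁, U₂ ⊆ V` with `|U₁| > |U₂|` such that
(i) every directed path from a vertex of `U₁` to a vertex of `X` traverses a
vertex of `U₂`, and (ii) for `{i,j} = {1,2}`, every directed path from a vertex of
`Uᵢ` to another vertex of `Uᵢ` traverses a vertex of `Uⱼ`, then `N` is
tree-based. -/
theorem stmt_3 {V : Type} [Fintype V] [DecidableEq V] (N : Network V)
    (hN : IsPhyloNetwork N)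
    (h : ¬ ∃ U₁ U₂ : Finset V, BadPair N U₁ U₂) :
    TreeBased N := by
  classical
  have hall : ∀ S : Finset {v : V // v ∉ N.X},
      S.card ≤ (S.biUnion fun s => Finset.univ.filter fun w => ((s : V), w) ∈ N.E).card := by
    intro S
    by_contra hlt
    push Not at hlt
    refine h (bad_of_hall N hN (S.map (Function.Embedding.subtype _)) ?_ ?_)
    · intro s hs
      simp only [Finset.mem_map, Function.Embedding.subtype_apply] at hs
      obtain ⟨a, -, rfl⟩ := hs
      exact a.2
    · rw [Finset.card_map]
      refine lt_of_le_of_lt (Finset.card_le_card ?_) hlt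
      intro w hw
      simp only [Finset.mem_biUnion, Finset.mem_map, Function.Embedding.subtype_apply,
        Finset.mem_filter, Finset.mem_univ, true_and] at hw ⊢
      obtain ⟨_, ⟨a, ha, rfl⟩, hE⟩ := hw
      exact ⟨a, ha, hE⟩
  obtain ⟨f, hf, hm⟩ := (Finset.all_card_le_biUnion_card_iff_exists_injective _).1 hall
  exact tb_of_matching N hN f hf fun v => by simpa using hm v
end

section
/- A binary phylogenetic network N = (V,E) on X is tree-based if and only if N has an antichain A ⊆ V and a partition Π of V into |A| blocks, each of which is the vertex set of a directed path in N ending at a leaf in X. -/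
open Finset

variable {V : Type} [Fintype V] [DecidableEq V]

theorem wf_of_acyclic (E : Finset (V × V))
    (h : ∀ v : V, ¬ Relation.TransGen (adjOf E) v v) :
    WellFounded (adjOf E) := by
  have h1 : WellFounded (Relation.TransGen (adjOf E)) := by
    haveI : Std.Irrefl (Relation.TransGen (adjOf E)) := ⟨h⟩
    exact Finite.wellFounded_of_trans_of_irrefl _
  exact Subrelation.wf (fun hab => Relation.TransGen.single hab) h1

theorem wf_of_acyclic_swap (E : Finset (V × V))
    (h : ∀ v : V, ¬ Relation.TransGen (adjOf E) v v) :
    WellFounded (Function.swap (adjOf E)) := by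
  have h1 : WellFounded (Function.swap (Relation.TransGen (adjOf E))) := by
    haveI : Std.Irrefl (Function.swap (Relation.TransGen (adjOf E))) := ⟨h⟩
    haveI : IsTrans V (Function.swap (Relation.TransGen (adjOf E))) :=
      ⟨fun _ _ _ hab hbc => Relation.TransGen.trans hbc hab⟩
    exact Finite.wellFounded_of_trans_of_irrefl _
  exact Subrelation.wf (r := Function.swap (Relation.TransGen (adjOf E)))
    (fun {x y} (hab : adjOf E y x) => (Relation.TransGen.single hab : Relation.TransGen (adjOf E) y x)) h1

theorem exists_walk (E : Finset (V × V)) (X : Finset V)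
    (h : ∀ v : V, ¬ Relation.TransGen (adjOf E) v v) (f : V → V)
    (hf : ∀ v, v ∉ X → (v, f v) ∈ E) (v : V) :
    ∃ p : List V, p.head? = some v ∧ IsDirPath E p ∧ EndsIn X p ∧
      ∀ w, w ∈ p ↔ Relation.ReflTransGen (fun a b => a ∉ X ∧ b = f a) v w := by
  induction v using (wf_of_acyclic_swap E h).induction with
  | _ v ih =>
  by_cases hv : v ∈ X
  · refine ⟨[v], rfl, ⟨by simp, List.isChain_singleton _, by simp⟩, ⟨v, hv, rfl⟩, fun w => ?_⟩
    rw [List.mem_singleton]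
    constructor
    · rintro rfl; exact .refl
    · intro hw
      rcases Relation.ReflTransGen.cases_head hw with h0 | ⟨c, hc, _⟩
      · exact h0.symm
      · exact absurd hv hc.1
  · obtain ⟨p, hp0, ⟨hp1, hp2, hp3⟩, ⟨x, hx, hpx⟩, hp4⟩ := ih (f v) (hf v hv)
    have hmono : ∀ a b, Relation.ReflTransGen (fun a b => a ∉ X ∧ b = f a) a b →
        Relation.ReflTransGen (adjOf E) a b := by
      intro a b hab
      refine Relation.ReflTransGen.mono ?_ _ _ hab
      rintro a b ⟨ha, rfl⟩
      exact hf a ha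
    refine ⟨v :: p, rfl, ⟨by simp, ?_, ?_⟩, ⟨x, hx, ?_⟩, fun w => ?_⟩
    · cases p with
      | nil => exact absurd rfl hp1
      | cons a l =>
        simp only [List.head?_cons, Option.some.injEq] at hp0
        subst hp0
        exact List.isChain_cons_cons.2 ⟨hf v hv, hp2⟩
    · rw [List.nodup_cons]
      refine ⟨fun hm => ?_, hp3⟩
      exact h v (Relation.TransGen.head' (hf v hv) (hmono _ _ ((hp4 v).1 hm)))
    · cases p with
      | nil => exact absurd rfl hp1
      | cons a l => rw [List.getLast?_cons_cons]; exact hpx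
    · rw [List.mem_cons, hp4]
      constructor
      · rintro (rfl | hw)
        · exact .refl
        · exact Relation.ReflTransGen.head ⟨hv, rfl⟩ hw
      · intro hw
        rcases Relation.ReflTransGen.cases_head hw with h0 | ⟨c, hc, hcw⟩
        · exact Or.inl h0.symm
        · right; rw [← hc.2]; exact hcw

theorem forward_dir (N : Network V)
    (hN : IsPhyloNetwork N) (hT : TreeBased N) : AntichainPartition N := by
  obtain ⟨_, hac, _, _, hX, _⟩ := hN
  obtain ⟨E', r, hE', ⟨hr, hin, _⟩, hleaf⟩ := hT
  have hin1 : ∀ v, inDeg E' v ≤ 1 := by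
    intro v
    by_cases hv : v = r
    · rw [hv, hr]; exact Nat.zero_le _
    · exact (hin v hv).le
  have hex : ∀ v, ∃ w, v ∉ N.X → (v, w) ∈ E' := by
    intro v
    by_cases hv : v ∈ N.X
    · exact ⟨v, fun h => absurd hv h⟩
    · have h0 : outDeg E' v ≠ 0 := fun h => hv (hleaf v h)
      obtain ⟨⟨a, b⟩, he⟩ := Finset.card_ne_zero.1 h0
      simp only [Finset.mem_filter] at he
      obtain ⟨he, rfl⟩ := he
      exact ⟨b, fun _ => he⟩
  choose f hf using hex
  have hfE : ∀ v, v ∉ N.X → (v, f v) ∈ N.E := fun v hv => hE' (hf v hv)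
  have hinj : ∀ u v, u ∉ N.X → v ∉ N.X → f u = f v → u = v := by
    intro u v hu hv huv
    have := Finset.card_le_one.1 (hin1 (f v)) (u, f u) (Finset.mem_filter.2 ⟨hf u hu, huv⟩)
      (v, f v) (by simp [hf v hv])
    exact (Prod.mk.inj this).1
  choose walk hw1 hw2 hw3 hw4 using exists_walk N.E N.X hac f hfE
  have hwinj : Function.Injective walk := by
    intro a b hab
    have := hw1 a
    rw [hab, hw1 b] at this
    exact (Option.some.inj this).symm
  set I : Finset V := (N.Xᶜ).image f with hI
  refine ⟨N.X, (Iᶜ).image walk, ?_, ?_, ?_, ?_⟩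
  · intro u hu v _ huv hreach
    rcases Relation.ReflTransGen.cases_head hreach with h0 | ⟨c, hc, _⟩
    · exact huv h0
    · rw [hX, Finset.mem_filter] at hu
      have := Finset.card_eq_zero.1 hu.2
      have hmem : (u, c) ∈ N.E.filter (fun e => e.1 = u) := by
        exact Finset.mem_filter.2 ⟨hc, rfl⟩
      rw [this] at hmem
      simp at hmem
  · rw [Finset.card_image_of_injective _ hwinj, Finset.card_compl, hI,
      Finset.card_image_of_injOn, Finset.card_compl]
    · have := Finset.card_le_univ N.X
      omega
    · intro a ha b hb hab
      exact hinj a b (by simpa using ha) (by simpa using hb) hab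
  · intro p hp
    obtain ⟨a, _, rfl⟩ := Finset.mem_image.1 hp
    exact ⟨hw2 a, hw3 a⟩
  · intro v
    have hstart : ∃ u, u ∉ I ∧
        Relation.ReflTransGen (fun a b => a ∉ N.X ∧ b = f a) u v := by
      induction v using (wf_of_acyclic N.E hac).induction with
      | _ v ih =>
      by_cases hv : v ∈ I
      · obtain ⟨a, ha, rfl⟩ := Finset.mem_image.1 hv
        have ha' : a ∉ N.X := by simpa using ha
        obtain ⟨u, hu, hua⟩ := ih a (hfE a ha')
        exact ⟨u, hu, hua.tail ⟨ha', rfl⟩⟩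
      · exact ⟨v, hv, .refl⟩
    have huniq : ∀ w, Relation.ReflTransGen (fun a b => a ∉ N.X ∧ b = f a) w v →
        ∀ u, u ∉ I → w ∉ I →
        Relation.ReflTransGen (fun a b => a ∉ N.X ∧ b = f a) u v → w = u := by
      clear hstart
      intro w hw u hu hwI huv
      induction hw with
      | refl =>
        rcases Relation.ReflTransGen.cases_tail huv with h0 | ⟨c, _, hc, rfl⟩
        · exact h0
        · exact absurd (Finset.mem_image_of_mem f (by simpa using hc)) hwI
      | tail hwb hbc ih =>
        obtain ⟨hb, rfl⟩ := hbc
        rcases Relation.ReflTransGen.cases_tail huv with h0 | ⟨c, huc, hc, hfc⟩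
        · rw [← h0] at hu
          exact absurd (Finset.mem_image_of_mem f (by simpa using hb)) hu
        · have := hinj _ _ hb hc hfc
          subst this
          exact ih huc
    obtain ⟨u, hu, huv⟩ := hstart
    refine ⟨walk u, ⟨Finset.mem_image_of_mem _ (by simpa using hu), (hw4 u v).2 huv⟩, ?_⟩
    rintro q ⟨hq, hvq⟩
    obtain ⟨w, hw, rfl⟩ := Finset.mem_image.1 hq
    rw [huniq w ((hw4 w v).1 hvq) u hu (by simpa using hw) huv]

theorem backward_dir (N : Network V)
    (hN : IsPhyloNetwork N) (hA : AntichainPartition N) : TreeBased N := by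
  obtain ⟨_, hac, hr, hreach, hX, _⟩ := hN
  obtain ⟨A, P, _, _, hP, hpart⟩ := hA
  have hex : ∀ v, ∃ w, v ∉ N.X → (v, w) ∈ N.E ∧
      ∃ p ∈ P, ∃ (i : ℕ) (hi : i + 1 < p.length), p[i] = v ∧ p[i + 1] = w := by
    intro v
    obtain ⟨p, ⟨hp, hvp⟩, _⟩ := hpart v
    obtain ⟨⟨_, hch, _⟩, x, hx, hlast⟩ := hP p hp
    obtain ⟨i, hi, hiv⟩ := List.getElem_of_mem hvp
    by_cases hi' : i + 1 < p.length
    · refine ⟨p[i + 1], fun _ => ⟨?_, p, hp, i, hi', hiv, rfl⟩⟩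
      have := List.isChain_iff_getElem.1 hch i hi'
      rw [hiv] at this
      exact this
    · refine ⟨v, fun hv => absurd ?_ hv⟩
      have h1 : i = p.length - 1 := by omega
      rw [List.getLast?_eq_getElem?, ← h1, List.getElem?_eq_getElem hi, hiv] at hlast
      rw [Option.some.inj hlast]
      exact hx
  choose f hf using hex
  have hinj : ∀ u v, u ∉ N.X → v ∉ N.X → f u = f v → u = v := by
    intro u v hu hv huv
    obtain ⟨_, p, hp, i, hi, hpi, hpi1⟩ := hf u hu
    obtain ⟨_, q, hq, j, hj, hqj, hqj1⟩ := hf v hv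
    have hpq : p = q := by
      refine (hpart (f u)).unique ⟨hp, ?_⟩ ⟨hq, ?_⟩
      · rw [← hpi1]; exact List.getElem_mem _
      · rw [huv, ← hqj1]; exact List.getElem_mem _
    subst hpq
    have hnd := (hP p hp).1.2.2
    have hij : i + 1 = j + 1 := (hnd.getElem_inj_iff).1 (by rw [hpi1, hqj1, huv])
    have hij' : i = j := by omega
    subst hij'
    rw [← hpi, ← hqj]
  have hroot : ∀ a, (a, N.root) ∉ N.E := by
    intro a ha
    have := Finset.card_eq_zero.1 hr
    have hmem : (a, N.root) ∈ N.E.filter (fun e => e.2 = N.root) := by simpa using ha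
    rw [this] at hmem
    simp at hmem
  have hpar : ∀ v, ∃ u, v ≠ N.root → (u, v) ∈ N.E ∧ ∀ w, w ∉ N.X → f w = v → u = w := by
    intro v
    by_cases hv : ∃ w, w ∉ N.X ∧ f w = v
    · obtain ⟨w, hw, rfl⟩ := hv
      exact ⟨w, fun _ => ⟨(hf w hw).1, fun w' hw' h => hinj _ _ hw hw' h.symm⟩⟩
    · rcases Relation.ReflTransGen.cases_tail (hreach v) with h0 | ⟨c, _, hc⟩
      · exact ⟨v, fun h => absurd h0 h⟩
      · exact ⟨c, fun _ => ⟨hc, fun w hw h => absurd ⟨w, hw, h⟩ hv⟩⟩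
  choose par hpar using hpar
  refine ⟨(Finset.univ.filter (fun v => v ≠ N.root)).image (fun v => (par v, v)), N.root,
    ?_, ⟨?_, ?_, ?_⟩, ?_⟩
  · intro e he
    obtain ⟨v, hv, rfl⟩ := Finset.mem_image.1 he
    exact (hpar v (by simpa using hv)).1
  · rw [inDeg, Finset.card_eq_zero, Finset.filter_eq_empty_iff]
    intro e he
    obtain ⟨v, hv, rfl⟩ := Finset.mem_image.1 he
    simpa using hv
  · intro v hv
    rw [inDeg, Finset.card_eq_one]
    refine ⟨(par v, v), ?_⟩
    ext ⟨a, b⟩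
    simp only [Finset.mem_filter, Finset.mem_image, Finset.mem_univ, true_and,
      Finset.mem_singleton, Prod.mk.injEq]
    constructor
    · rintro ⟨⟨w, _, rfl, rfl⟩, rfl⟩
      exact ⟨rfl, rfl⟩
    · rintro ⟨rfl, rfl⟩
      exact ⟨⟨b, hv, rfl, rfl⟩, rfl⟩
  · intro v
    induction v using (wf_of_acyclic N.E hac).induction with
    | _ v ih =>
    by_cases hv : v = N.root
    · rw [hv]
    · refine (ih (par v) (hpar v hv).1).tail ?_
      exact Finset.mem_image_of_mem (fun v => (par v, v)) (by simpa using hv)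
  · intro v h0
    by_contra hv
    have hfr : f v ≠ N.root := by
      intro h
      have := (hf v hv).1
      rw [h] at this
      exact hroot v this
    have hpv := (hpar (f v) hfr).2 v hv rfl
    rw [outDeg, Finset.card_eq_zero, Finset.filter_eq_empty_iff] at h0
    exact h0 (Finset.mem_image_of_mem (fun v => (par v, v))
      (show f v ∈ _ by simpa using hfr)) hpv

/-- `N` is tree-based iff `N` has an antichain `A ⊆ V` and a
partition of `V` into `|A|` blocks, each the vertex set of a directed path in `N`
ending at a leaf in `X`. -/
theorem stmt_6 {V : Type} [Fintype V] [DecidableEq V] (N : Network V)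
    (hN : IsPhyloNetwork N) :
    TreeBased N ↔ AntichainPartition N := by
  exact ⟨forward_dir N hN, backward_dir N hN⟩
end

section
/- A binary phylogenetic network N = (V,E) on X is tree-based if and only if for every subset U ⊆ V there exists a set of pairwise vertex-disjoint directed paths in N, each ending at a leaf in X, such that each element of U lies on exactly one of these paths. -/
open Finset

variable {V : Type} [Fintype V] [DecidableEq V]

theorem aux_wf (E : Finset (V × V)) (h : ∀ v : V, ¬ Relation.TransGen (adjOf E) v v) :
    WellFounded (Relation.TransGen (adjOf E)) := by
  have : IsTrans V (Relation.TransGen (adjOf E)) := ⟨fun _ _ _ => Relation.TransGen.trans⟩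
  have : Std.Irrefl (Relation.TransGen (adjOf E)) := ⟨h⟩
  exact Finite.wellFounded_of_trans_of_irrefl _

theorem aux_wf' (E : Finset (V × V)) (h : ∀ v : V, ¬ Relation.TransGen (adjOf E) v v) :
    WellFounded (fun a b => Relation.TransGen (adjOf E) b a) := by
  have : IsTrans V (fun a b => Relation.TransGen (adjOf E) b a) :=
    ⟨fun _ _ _ h1 h2 => Relation.TransGen.trans h2 h1⟩
  have : Std.Irrefl (fun a b => Relation.TransGen (adjOf E) b a) := ⟨h⟩
  exact Finite.wellFounded_of_trans_of_irrefl _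

theorem aux_nodup (E : Finset (V × V)) (h : ∀ v : V, ¬ Relation.TransGen (adjOf E) v v)
    (p : List V) (hp : List.IsChain (adjOf E) p) : p.Nodup := by
  have : IsTrans V (Relation.TransGen (adjOf E)) := ⟨fun _ _ _ => Relation.TransGen.trans⟩
  have h1 : List.IsChain (Relation.TransGen (adjOf E)) p :=
    hp.imp (fun _ _ h => Relation.TransGen.single h)
  have h2 := h1.pairwise
  refine List.Pairwise.imp (S := fun a b : V => a ≠ b) ?_ h2
  rintro a b hab rfl
  exact h a hab

theorem aux_forward (N : Network V)
    (hac : ∀ v : V, ¬ Relation.TransGen (adjOf N.E) v v) (hT : TreeBased N)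
    (U : Finset V) : CoversExactly N U := by
  classical
  obtain ⟨E', r, hsub, ⟨hr, hin, -⟩, hleaf⟩ := hT
  have hex : ∀ v : V, ∃ w : V, v ∉ N.X → (v, w) ∈ E' := by
    intro v
    by_cases hv : v ∈ N.X
    · exact ⟨v, fun h => absurd hv h⟩
    · have h0 : outDeg E' v ≠ 0 := fun h => hv (hleaf v h)
      obtain ⟨e, he⟩ := Finset.card_ne_zero.mp h0
      rw [Finset.mem_filter] at he
      refine ⟨e.2, fun _ => ?_⟩
      rw [← he.2]
      exact he.1
  choose f hf using hex
  have hinj : ∀ a b : V, a ∉ N.X → b ∉ N.X → f a = f b → a = b := by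
    intro a b ha hb hab
    have hle : inDeg E' (f a) ≤ 1 := by
      by_cases h : f a = r
      · rw [h, hr]; omega
      · rw [hin _ h]
    have := Finset.card_le_one.mp hle (a, f a) (by simp [hf a ha]) (b, f b)
      (by simp [hf b hb, hab])
    exact (Prod.mk.inj this).1
  have hL : ∀ v : V, ∃ L : List V, L ≠ [] ∧ List.IsChain (adjOf N.E) L ∧ EndsIn N.X L ∧
      L.head? = some v ∧ (∀ w ∈ L, w = v ∨ ∃ u ∈ L, u ∉ N.X ∧ f u = w) ∧
      (∀ u ∈ L, u ∉ N.X → f u ∈ L) := by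
    intro v
    induction v using (aux_wf' N.E hac).induction with
    | _ v ih =>
    by_cases hv : v ∈ N.X
    · exact ⟨[v], by simp, by simp, ⟨v, hv, by simp⟩, by simp, by simp, by simp [hv]⟩
    · have hadj : adjOf N.E v (f v) := hsub (hf v hv)
      obtain ⟨L, h1, h2, ⟨x, hx, hx'⟩, h4, h5, h6⟩ := ih (f v) (Relation.TransGen.single hadj)
      obtain ⟨a, L', rfl⟩ := List.exists_cons_of_ne_nil h1
      simp only [List.head?_cons, Option.some.injEq] at h4
      subst h4
      refine ⟨v :: f v :: L', by simp, ?_, ⟨x, hx, ?_⟩, by simp, ?_, ?_⟩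
      · exact List.isChain_cons_cons.mpr ⟨hadj, h2⟩
      · rw [List.getLast?_cons_cons]; exact hx'
      · intro w hw
        rcases List.mem_cons.mp hw with rfl | hw
        · exact Or.inl rfl
        · right
          rcases h5 w hw with rfl | ⟨u, hu, hu'⟩
          · exact ⟨v, by simp, hv, rfl⟩
          · exact ⟨u, List.mem_cons_of_mem _ hu, hu'⟩
      · intro u hu hu'
        rcases List.mem_cons.mp hu with rfl | hu
        · simp
        · exact List.mem_cons_of_mem _ (h6 u hu hu')
  choose L h1 h2 h3 h4 h5 h6 using hL
  have hmem : ∀ v, v ∈ L v := fun v => List.mem_of_mem_head? (by rw [h4 v]; simp)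
  have key : ∀ v s t : V, (∀ u, u ∉ N.X → f u ≠ s) → (∀ u, u ∉ N.X → f u ≠ t) →
      v ∈ L s → v ∈ L t → s = t := by
    intro v
    induction v using (aux_wf N.E hac).induction with
    | _ v ih =>
    intro s t hs ht hvs hvt
    rcases h5 s v hvs with rfl | ⟨u, hu, hu1, hu2⟩
    · rcases h5 t v hvt with rfl | ⟨u, hu, hu1, hu2⟩
      · rfl
      · exact absurd hu2 (hs u hu1)
    · rcases h5 t v hvt with rfl | ⟨u', hu', hu1', hu2'⟩
      · exact absurd hu2 (ht u hu1)
      · have : u = u' := hinj u u' hu1 hu1' (hu2.trans hu2'.symm)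
        subst this
        refine ih u (Relation.TransGen.single ?_) s t hs ht hu hu'
        rw [← hu2]
        exact hsub (hf u hu1)
  have hcov : ∀ v : V, ∃ s : V, (∀ u, u ∉ N.X → f u ≠ s) ∧ v ∈ L s := by
    intro v
    induction v using (aux_wf N.E hac).induction with
    | _ v ih =>
    by_cases hv : ∀ u, u ∉ N.X → f u ≠ v
    · exact ⟨v, hv, hmem v⟩
    · push Not at hv
      obtain ⟨u, hu, rfl⟩ := hv
      obtain ⟨s, hs, hs'⟩ := ih u (Relation.TransGen.single (hsub (hf u hu)))
      exact ⟨s, hs, h6 s u hs' hu⟩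
  refine ⟨(Finset.univ.filter fun s => ∀ u, u ∉ N.X → f u ≠ s).image L, ?_, ?_, ?_⟩
  · intro p hp
    obtain ⟨s, -, rfl⟩ := Finset.mem_image.mp hp
    exact ⟨⟨h1 s, h2 s, aux_nodup _ hac _ (h2 s)⟩, h3 s⟩
  · intro p hp q hq hpq v hvp hvq
    obtain ⟨s, hs, rfl⟩ := Finset.mem_image.mp hp
    obtain ⟨t, ht, rfl⟩ := Finset.mem_image.mp hq
    exact hpq (by rw [key v s t (Finset.mem_filter.mp hs).2 (Finset.mem_filter.mp ht).2 hvp hvq])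
  · intro v _
    obtain ⟨s, hs, hvs⟩ := hcov v
    refine ⟨L s, ⟨Finset.mem_image.mpr ⟨s, by simpa using hs, rfl⟩, hvs⟩, ?_⟩
    rintro q ⟨hq, hvq⟩
    obtain ⟨t, ht, rfl⟩ := Finset.mem_image.mp hq
    rw [key v s t hs (Finset.mem_filter.mp ht).2 hvs hvq]

theorem aux_backward (N : Network V)
    (hac : ∀ v : V, ¬ Relation.TransGen (adjOf N.E) v v)
    (hroot : inDeg N.E N.root = 0)
    (hreach : ∀ v : V, Relation.ReflTransGen (adjOf N.E) N.root v)
    (hC : CoversExactly N Finset.univ) : TreeBased N := by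
  classical
  obtain ⟨P, hP, hdis, hcov⟩ := hC
  have hnoroot : ∀ a : V, (a, N.root) ∉ N.E := by
    intro a ha
    have := Finset.card_eq_zero.mp hroot
    have h : (a, N.root) ∈ N.E.filter (fun e => e.2 = N.root) := by simp [ha]
    rw [this] at h
    simp at h
  let Nx : V → V → Prop := fun v w =>
    ∃ p ∈ P, ∃ i : ℕ, ∃ h : i + 1 < p.length, p[i] = v ∧ p[i+1] = w
  have hNxE : ∀ v w, Nx v w → (v, w) ∈ N.E := by
    rintro v w ⟨p, hp, i, hi, rfl, rfl⟩
    have hc : List.IsChain (adjOf N.E) p := (hP p hp).1.2.1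
    exact List.isChain_iff_getElem.mp hc i hi
  have hNxinj : ∀ v v' w, Nx v w → Nx v' w → v = v' := by
    rintro v v' w ⟨p, hp, i, hi, hv, hw⟩ ⟨q, hq, j, hj, hv', hw'⟩
    have hpq : p = q := by
      by_contra hne
      refine hdis p hp q hq hne w ?_ ?_
      · rw [← hw]; exact List.getElem_mem _
      · rw [← hw']; exact List.getElem_mem _
    subst hpq
    have := (List.Nodup.getElem_inj_iff (hP p hp).1.2.2).mp (hw.trans hw'.symm)
    have hij : i = j := by omega
    subst hij
    exact hv.symm.trans hv'
  have hNxex : ∀ v, v ∉ N.X → ∃ w, Nx v w := by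
    intro v hv
    obtain ⟨p, ⟨hp, hvp⟩, -⟩ := hcov v (Finset.mem_univ v)
    obtain ⟨i, hi, rfl⟩ := List.mem_iff_getElem.mp hvp
    by_cases h : i + 1 < p.length
    · exact ⟨p[i+1], p, hp, i, h, rfl, rfl⟩
    · exfalso
      obtain ⟨x, hx, hx'⟩ := (hP p hp).2
      rw [List.getLast?_eq_getElem?] at hx'
      have : p.length - 1 = i := by omega
      rw [this, List.getElem?_eq_getElem hi] at hx'
      exact hv (by rw [Option.some.inj hx']; exact hx)
  have hpar : ∀ w : V, ∃ v : V, w ≠ N.root → (v, w) ∈ N.E ∧ ∀ v', Nx v' w → v' = v := by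
    intro w
    by_cases hw : w = N.root
    · exact ⟨w, fun h => absurd hw h⟩
    · by_cases h : ∃ v, Nx v w
      · obtain ⟨v, hv⟩ := h
        exact ⟨v, fun _ => ⟨hNxE _ _ hv, fun v' hv' => hNxinj _ _ _ hv' hv⟩⟩
      · rcases Relation.ReflTransGen.cases_tail (hreach w) with h' | ⟨v, -, hv⟩
        · exact absurd h' hw
        · exact ⟨v, fun _ => ⟨hv, fun v' hv' => absurd ⟨v', hv'⟩ h⟩⟩
  choose π hπ using hpar
  have hmem : ∀ a b : V, (a, b) ∈ (Finset.univ.filter fun w => w ≠ N.root).image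
      (fun w => (π w, w)) ↔ b ≠ N.root ∧ a = π b := by
    intro a b
    simp only [Finset.mem_image, Finset.mem_filter, Finset.mem_univ, true_and, Prod.mk.injEq]
    constructor
    · rintro ⟨w, hw, h1, rfl⟩
      exact ⟨hw, h1.symm⟩
    · rintro ⟨hb, rfl⟩
      exact ⟨b, hb, rfl, rfl⟩
  refine ⟨(Finset.univ.filter fun w => w ≠ N.root).image (fun w => (π w, w)), N.root,
    ?_, ⟨?_, ?_, ?_⟩, ?_⟩
  · rintro ⟨a, b⟩ hab
    obtain ⟨hb, rfl⟩ := (hmem a b).mp hab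
    exact (hπ b hb).1
  · refine Finset.card_eq_zero.mpr (Finset.filter_eq_empty_iff.mpr ?_)
    rintro ⟨a, b⟩ hab hb
    exact ((hmem a b).mp hab).1 hb
  · intro v hv
    refine Finset.card_eq_one.mpr ⟨(π v, v), ?_⟩
    ext ⟨a, b⟩
    rw [Finset.mem_filter, hmem, Finset.mem_singleton, Prod.mk.injEq]
    constructor
    · rintro ⟨⟨-, rfl⟩, h⟩
      have h : b = v := h
      subst h
      exact ⟨rfl, rfl⟩
    · rintro ⟨rfl, rfl⟩
      exact ⟨⟨hv, rfl⟩, rfl⟩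
  · intro v
    induction v using (aux_wf N.E hac).induction with
    | _ v ih =>
    by_cases hv : v = N.root
    · rw [hv]
    · exact (ih (π v) (Relation.TransGen.single (hπ v hv).1)).tail ((hmem _ _).mpr ⟨hv, rfl⟩)
  · intro v hv
    by_contra hvX
    obtain ⟨w, hw⟩ := hNxex v hvX
    have hwr : w ≠ N.root := by
      rintro rfl
      exact hnoroot v (hNxE _ _ hw)
    have h := Finset.filter_eq_empty_iff.mp (Finset.card_eq_zero.mp hv)
      ((hmem v w).mpr ⟨hwr, (hπ w hwr).2 v hw⟩)
    exact h rfl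

/-- `N` is tree-based iff for every `U ⊆ V` there is a set of
pairwise vertex-disjoint directed paths in `N`, each ending at a leaf in `X`,
such that each element of `U` lies on exactly one of the paths. -/
theorem stmt_7 {V : Type} [Fintype V] [DecidableEq V] (N : Network V)
    (hN : IsPhyloNetwork N) :
    TreeBased N ↔ ∀ U : Finset V, CoversExactly N U := by
  exact ⟨fun h U => aux_forward N hN.2.1 h U,
    fun h => aux_backward N hN.2.1 hN.2.2.1 hN.2.2.2.1 (h Finset.univ)⟩
end

section
/- A binary phylogenetic network N = (V,E) on X is tree-based if and only if the vertex set V can be partitioned into the vertex sets of pairwise vertex-disjoint directed paths, each of which ends at a leaf in X. -/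
open Finset

variable {V : Type} [Fintype V] [DecidableEq V]

/-- A successor function: injective choice of a child for every non-leaf. -/
def SuccFun {V : Type} (N : Network V) (s : V → V) : Prop :=
  (∀ v, v ∉ N.X → (v, s v) ∈ N.E) ∧ ∀ u v, u ∉ N.X → v ∉ N.X → s u = s v → u = v

theorem wf_up {V : Type} [Fintype V] [DecidableEq V] (E : Finset (V × V))
    (h : ∀ v : V, ¬ Relation.TransGen (adjOf E) v v) : WellFounded (adjOf E) := by
  haveI : Std.Irrefl (Relation.TransGen (adjOf E)) := ⟨h⟩
  have := Finite.wellFounded_of_trans_of_irrefl (Relation.TransGen (adjOf E))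
  exact Subrelation.wf (fun h => Relation.TransGen.single h) this

theorem wf_down {V : Type} [Fintype V] [DecidableEq V] (E : Finset (V × V))
    (h : ∀ v : V, ¬ Relation.TransGen (adjOf E) v v) :
    WellFounded (fun a b => adjOf E b a) := by
  haveI : Std.Irrefl (Function.swap (Relation.TransGen (adjOf E))) := ⟨h⟩
  haveI : IsTrans V (Function.swap (Relation.TransGen (adjOf E))) :=
    ⟨fun a b c hab hbc => Relation.TransGen.trans hbc hab⟩
  have := Finite.wellFounded_of_trans_of_irrefl (Function.swap (Relation.TransGen (adjOf E)))
  exact Subrelation.wf (fun h => Relation.TransGen.single h) this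

theorem succ_of_treeBased {V : Type} [Fintype V] [DecidableEq V] (N : Network V)
    (h : TreeBased N) : ∃ s, SuccFun N s := by
  obtain ⟨E', r, hE, ⟨h0, h1, -⟩, hl⟩ := h
  have key : ∀ v, ∃ w, v ∉ N.X → (v, w) ∈ E' := by
    intro v
    by_cases hv : v ∈ N.X
    · exact ⟨v, fun h => absurd hv h⟩
    · have h2 : outDeg E' v ≠ 0 := fun h => hv (hl v h)
      obtain ⟨⟨a, b⟩, he⟩ := Finset.card_ne_zero.mp h2
      rw [Finset.mem_filter] at he
      obtain ⟨he, rfl⟩ := he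
      exact ⟨b, fun _ => he⟩
  choose s hs using key
  refine ⟨s, fun v hv => hE (hs v hv), fun u v hu hv huv => ?_⟩
  have hle : inDeg E' (s v) ≤ 1 := by
    by_cases hr : s v = r
    · rw [hr, h0]; omega
    · exact (h1 _ hr).le
  have := Finset.card_le_one.mp hle (u, s u) (Finset.mem_filter.2 ⟨hs u hu, huv⟩)
    (v, s v) (by simp [hs v hv])
  exact congrArg Prod.fst this

theorem treeBased_of_succ {V : Type} [Fintype V] [DecidableEq V] (N : Network V)
    (hN : IsPhyloNetwork N) (h : ∃ s, SuccFun N s) : TreeBased N := by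
  classical
  obtain ⟨s, hs, hinj⟩ := h
  obtain ⟨-, hac, hr0, hreach, -, -⟩ := hN
  have key : ∀ v, ∃ u, v ≠ N.root → (u, v) ∈ N.E ∧ ∀ w, w ∉ N.X → s w = v → u = w := by
    intro v
    by_cases hv : v = N.root
    · exact ⟨v, fun h => absurd hv h⟩
    by_cases hw : ∃ w, w ∉ N.X ∧ s w = v
    · obtain ⟨w, hw, rfl⟩ := hw
      exact ⟨w, fun _ => ⟨hs w hw, fun w' hw' e => hinj _ _ hw hw' e.symm⟩⟩
    · rcases Relation.ReflTransGen.cases_tail (hreach v) with h | ⟨c, -, hc⟩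
      · exact absurd h hv
      · exact ⟨c, fun _ => ⟨hc, fun w hwX e => absurd ⟨w, hwX, e⟩ hw⟩⟩
  choose p hp using key
  have hmem : ∀ e : V × V, e ∈ (Finset.univ.filter (fun v => v ≠ N.root)).image
      (fun v => (p v, v)) ↔ e.2 ≠ N.root ∧ e.1 = p e.2 := by
    rintro ⟨a, b⟩
    simp only [Finset.mem_image, Finset.mem_filter, Finset.mem_univ, true_and, Prod.mk.injEq]
    constructor
    · rintro ⟨v, hv, rfl, rfl⟩; exact ⟨hv, rfl⟩
    · rintro ⟨hb, rfl⟩; exact ⟨b, hb, rfl, rfl⟩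
  generalize (Finset.univ.filter (fun v => v ≠ N.root)).image (fun v => (p v, v)) = E' at hmem
  refine ⟨E', N.root, ?_, ⟨?_, ?_, ?_⟩, ?_⟩
  · rintro ⟨a, b⟩ he
    obtain ⟨hb, ha⟩ := (hmem _).1 he
    simp only at ha hb
    subst ha
    exact (hp b hb).1
  · unfold inDeg
    rw [Finset.card_eq_zero, Finset.filter_eq_empty_iff]
    intro e he
    exact ((hmem e).1 he).1
  · intro v hv
    unfold inDeg
    rw [Finset.card_eq_one]
    refine ⟨(p v, v), ?_⟩
    ext ⟨a, b⟩
    simp only [Finset.mem_filter, hmem, Finset.mem_singleton, Prod.mk.injEq]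
    constructor
    · rintro ⟨⟨_, rfl⟩, rfl⟩; exact ⟨rfl, rfl⟩
    · rintro ⟨rfl, rfl⟩; exact ⟨⟨hv, rfl⟩, rfl⟩
  · intro v
    induction v using (wf_up N.E hac).induction with
    | _ v ih =>
      by_cases hv : v = N.root
      · rw [hv]
      · exact (ih (p v) (hp v hv).1).tail ((hmem (p v, v)).2 ⟨hv, rfl⟩)
  · intro v hv
    by_contra hvX
    have hr : s v ≠ N.root := by
      intro h
      unfold inDeg at hr0
      rw [Finset.card_eq_zero, Finset.filter_eq_empty_iff] at hr0
      exact hr0 (hs v hvX) h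
    have h1 := (hp _ hr).2 v hvX rfl
    unfold outDeg at hv
    rw [Finset.card_eq_zero, Finset.filter_eq_empty_iff] at hv
    exact hv ((hmem (v, s v)).2 ⟨hr, h1.symm⟩) rfl

theorem nodup_pred {V : Type} {l1 l2 m1 m2 : List V} {u v w : V}
    (h : l1 ++ u :: w :: l2 = m1 ++ v :: w :: m2) (hn : (l1 ++ u :: w :: l2).Nodup) :
    u = v := by
  induction l1 generalizing m1 with
  | nil =>
    cases m1 with
    | nil => simp at h; exact h.1
    | cons a m =>
      cases m with
      | nil => simp at h hn; grind
      | cons b m => simp at h hn; grind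
  | cons c l ih =>
    cases m1 with
    | nil => cases l <;> simp at h hn <;> grind
    | cons a m =>
      simp only [List.cons_append, List.cons.injEq] at h
      exact ih h.2 (by simp only [List.cons_append, List.nodup_cons] at hn; exact hn.2)

theorem succ_of_partition {V : Type} [Fintype V] [DecidableEq V] (N : Network V)
    (h : PathPartitionProp N) : ∃ s, SuccFun N s := by
  obtain ⟨P, hP, hu⟩ := h
  have key : ∀ v, ∃ w, v ∉ N.X → (v, w) ∈ N.E ∧ ∃ p ∈ P, ∃ l1 l2, p = l1 ++ v :: w :: l2 := by
    intro v
    by_cases hv : v ∈ N.X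
    · exact ⟨v, fun h => absurd hv h⟩
    obtain ⟨p, ⟨hp, hvp⟩, -⟩ := hu v
    obtain ⟨l1, l2, rfl⟩ := List.append_of_mem hvp
    obtain ⟨⟨-, hc, -⟩, x, hx, hl⟩ := hP _ hp
    cases l2 with
    | nil =>
      simp at hl
      exact absurd (hl ▸ hx) hv
    | cons w l2 =>
      refine ⟨w, fun _ => ⟨?_, _, hp, l1, l2, rfl⟩⟩
      have := (List.isChain_append.1 hc).2.1
      exact (List.isChain_cons_cons.1 this).1
  choose s hs using key
  refine ⟨s, fun v hv => (hs v hv).1, fun u v hu' hv huv => ?_⟩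
  obtain ⟨-, p, hp, l1, l2, e1⟩ := hs u hu'
  obtain ⟨-, q, hq, m1, m2, e2⟩ := hs v hv
  have hpq : p = q := (hu (s u)).unique ⟨hp, by rw [e1]; simp⟩ ⟨hq, by rw [e2, huv]; simp⟩
  subst hpq
  have hn := (hP p hp).1.2.2
  rw [← huv] at e2
  exact nodup_pred (e1.symm.trans e2) (e1 ▸ hn)

theorem partition_of_succ {V : Type} [Fintype V] [DecidableEq V] (N : Network V)
    (hN : IsPhyloNetwork N) (h : ∃ s, SuccFun N s) : PathPartitionProp N := by
  classical
  obtain ⟨s, hs, hinj⟩ := h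
  obtain ⟨-, hac, -, -, -, -⟩ := hN
  have key : ∀ v, ∃ l : List V, l.head? = some v ∧ List.IsChain (adjOf N.E) l ∧
      EndsIn N.X l ∧ (∀ u ∈ l, u ∉ N.X → s u ∈ l) ∧
      (∀ u ∈ l, u = v ∨ ∃ u' ∈ l, u' ∉ N.X ∧ s u' = u) := by
    intro v
    induction v using (wf_down N.E hac).induction with
    | _ v ih =>
      by_cases hv : v ∈ N.X
      · exact ⟨[v], rfl, by simp, ⟨v, hv, rfl⟩, by simp [hv], by simp⟩
      · obtain ⟨l, h1, h2, ⟨x, hx, hlx⟩, h4, h5⟩ := ih (s v) (hs v hv)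
        obtain ⟨t, rfl⟩ : ∃ t, l = s v :: t := by
          cases l with
          | nil => simp at h1
          | cons a t => simp at h1; exact ⟨t, by rw [h1]⟩
        refine ⟨v :: s v :: t, rfl, ?_, ⟨x, hx, ?_⟩, ?_, ?_⟩
        · exact List.isChain_cons_cons.2 ⟨hs v hv, h2⟩
        · rw [List.getLast?_cons_cons]; exact hlx
        · intro u hu huX
          rcases List.mem_cons.1 hu with rfl | hu
          · simp
          · exact List.mem_cons_of_mem _ (h4 u hu huX)
        · intro u hu
          rcases List.mem_cons.1 hu with rfl | hu
          · exact Or.inl rfl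
          · right
            rcases h5 u hu with rfl | ⟨u', hu', h⟩
            · exact ⟨v, by simp, hv, rfl⟩
            · exact ⟨u', List.mem_cons_of_mem _ hu', h⟩
  choose f f1 f2 f3 f4 f5 using key
  refine ⟨(Finset.univ.filter (fun v => ¬ ∃ u, u ∉ N.X ∧ s u = v)).image f, ?_, ?_⟩
  · intro p hp
    obtain ⟨a, -, rfl⟩ := Finset.mem_image.1 hp
    refine ⟨⟨?_, f2 a, ?_⟩, f3 a⟩
    · intro h
      have := f1 a
      rw [h] at this
      simp at this
    · have h1 : List.IsChain (Relation.TransGen (adjOf N.E)) (f a) :=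
        (f2 a).imp (fun _ _ h => Relation.TransGen.single h)
      have h2 := List.isChain_iff_pairwise.1 h1
      exact List.Pairwise.imp (S := (· ≠ ·)) (fun {a b} h e => by subst e; exact hac _ h) h2
  · intro v
    have main : ∃ a, (¬ ∃ u, u ∉ N.X ∧ s u = a) ∧ v ∈ f a ∧
        ∀ b, (¬ ∃ u, u ∉ N.X ∧ s u = b) → v ∈ f b → b = a := by
      induction v using (wf_up N.E hac).induction with
      | _ v ih =>
        by_cases hv : ∃ u, u ∉ N.X ∧ s u = v
        · obtain ⟨u, hu, rfl⟩ := hv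
          obtain ⟨a, ha, hua, huniq⟩ := ih u (hs u hu)
          refine ⟨a, ha, f4 a u hua hu, fun b hb hmb => huniq b hb ?_⟩
          rcases f5 b _ hmb with h | ⟨u', hu', hX, he⟩
          · exact absurd ⟨u, hu, h⟩ hb
          · rwa [← hinj _ _ hX hu he]
        · refine ⟨v, hv, List.mem_of_head? (f1 v), fun b hb hmb => ?_⟩
          rcases f5 b _ hmb with h | ⟨u', hu', hX, he⟩
          · exact h.symm
          · exact absurd ⟨u', hX, he⟩ hv
    obtain ⟨a, ha, hva, huniq⟩ := main
    refine ⟨f a, ⟨Finset.mem_image_of_mem _ (by simpa using ha), hva⟩, ?_⟩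
    rintro q ⟨hq, hvq⟩
    obtain ⟨b, hb, rfl⟩ := Finset.mem_image.1 hq
    rw [huniq b (Finset.mem_filter.1 hb).2 hvq]

/-- `N` is tree-based iff the vertex set `V` can be partitioned into
the vertex sets of pairwise vertex-disjoint directed paths, each of which ends at
a leaf in `X`. -/
theorem stmt_9 {V : Type} [Fintype V] [DecidableEq V] (N : Network V)
    (hN : IsPhyloNetwork N) :
    TreeBased N ↔ PathPartitionProp N :=
  ⟨fun h => partition_of_succ N hN (succ_of_treeBased N h),
   fun h => treeBased_of_succ N hN (succ_of_partition N h)⟩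
end

section
/- A binary phylogenetic network N = (V,E) on X is tree-based if and only if the bipartite graph G_N has a matching of size |V| − |X|. -/
open Finset

variable {V : Type} [Fintype V] [DecidableEq V]

/-- `N` is tree-based iff the bipartite graph `G_N` has a matching
of size `|V| - |X|`. -/
theorem stmt_10 {V : Type} [Fintype V] [DecidableEq V] (N : Network V)
    (hN : IsPhyloNetwork N) :
    TreeBased N ↔
      ∃ M : Finset (V × V), IsMatching N.E M ∧
        M.card = Fintype.card V - N.X.card := by
  classical
  obtain ⟨-, hacyc, hroot, hreach, hX, -⟩ := hN
  have hXmem : ∀ v, v ∈ N.X ↔ ∀ w, (v, w) ∉ N.E := by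
    intro v
    rw [hX]
    simp only [Finset.mem_filter, Finset.mem_univ, true_and, outDeg, Finset.card_eq_zero,
      Finset.filter_eq_empty_iff]
    constructor
    · intro h w hw
      exact h hw rfl
    · rintro h ⟨a, b⟩ hab rfl
      exact h b hab
  constructor
  · rintro ⟨E', r, hsub, ⟨hr, hin, -⟩, hleaf⟩
    have hex : ∀ v, v ∉ N.X → ∃ w, (v, w) ∈ E' := by
      intro v hv
      by_contra hcon
      push Not at hcon
      apply hv
      apply hleaf
      rw [outDeg, Finset.card_eq_zero, Finset.filter_eq_empty_iff]
      rintro ⟨a, b⟩ hab rfl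
      exact hcon b hab
    have hle : ∀ v, inDeg E' v ≤ 1 := by
      intro v
      by_cases h : v = r
      · subst h; omega
      · exact (hin v h).le
    choose! f hf using hex
    refine ⟨(Finset.univ \ N.X).image (fun v => (v, f v)), ⟨?_, ?_⟩, ?_⟩
    · intro e he
      simp only [Finset.mem_image, Finset.mem_sdiff, Finset.mem_univ, true_and] at he
      obtain ⟨v, hv, rfl⟩ := he
      exact hsub (hf v hv)
    · intro e he e' he' hne
      simp only [Finset.mem_image, Finset.mem_sdiff, Finset.mem_univ, true_and] at he he'
      obtain ⟨v, hv, rfl⟩ := he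
      obtain ⟨w, hw, rfl⟩ := he'
      have hvw : v ≠ w := by
        rintro rfl
        exact hne rfl
      refine ⟨hvw, ?_⟩
      intro heq
      have h1 := Finset.card_le_one.mp (hle (f w)) (v, f v)
        (Finset.mem_filter.mpr ⟨hf v hv, heq⟩) (w, f w)
        (Finset.mem_filter.mpr ⟨hf w hw, rfl⟩)
      exact hne h1
    · rw [Finset.card_image_of_injective _ (fun a b h => (Prod.mk.inj h).1),
        Finset.card_sdiff_of_subset (Finset.subset_univ _), Finset.card_univ]
  · rintro ⟨M, ⟨hsub, hM⟩, hcard⟩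
    have hfirst : M.image Prod.fst = Finset.univ \ N.X := by
      apply Finset.eq_of_subset_of_card_le
      · intro v hv
        obtain ⟨⟨a, b⟩, he, rfl⟩ := Finset.mem_image.mp hv
        simp only [Finset.mem_sdiff, Finset.mem_univ, true_and]
        intro h
        exact (hXmem _).mp h b (hsub he)
      · rw [Finset.card_sdiff_of_subset (Finset.subset_univ _), Finset.card_univ, ← hcard,
          Finset.card_image_of_injOn]
        intro e he e' he' h
        by_contra hne
        exact (hM e he e' he' hne).1 h
    have hpar : ∀ v, v ≠ N.root →
        ∃ u, (u, v) ∈ N.E ∧ ∀ w, (w, v) ∈ M → w = u := by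
      intro v hv
      by_cases h : ∃ u, (u, v) ∈ M
      · obtain ⟨u, hu⟩ := h
        refine ⟨u, hsub hu, ?_⟩
        intro w hw
        by_contra hne
        exact (hM _ hw _ hu (fun h => hne (Prod.mk.inj h).1)).2 rfl
      · rcases Relation.ReflTransGen.cases_tail (hreach v) with h' | ⟨u, -, hu⟩
        · exact absurd h' hv
        · exact ⟨u, hu, fun w hw => absurd ⟨w, hw⟩ h⟩
    have hnoroot : ∀ u, (u, N.root) ∉ N.E := by
      intro u hu
      rw [inDeg, Finset.card_eq_zero, Finset.filter_eq_empty_iff] at hroot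
      exact hroot hu rfl
    choose! p hpE hpM using hpar
    have hmem : ∀ a b, (a, b) ∈ (Finset.univ.erase N.root).image (fun v => (p v, v)) ↔
        b ≠ N.root ∧ a = p b := by
      intro a b
      simp only [Finset.mem_image, Finset.mem_erase, Finset.mem_univ, and_true, Prod.mk.injEq]
      constructor
      · rintro ⟨v, hv, rfl, rfl⟩
        exact ⟨hv, rfl⟩
      · rintro ⟨hb, rfl⟩
        exact ⟨b, hb, rfl, rfl⟩
    refine ⟨(Finset.univ.erase N.root).image (fun v => (p v, v)), N.root, ?_, ⟨?_, ?_, ?_⟩, ?_⟩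
    · rintro ⟨a, b⟩ hab
      obtain ⟨hb, rfl⟩ := (hmem a b).mp hab
      exact hpE b hb
    · rw [inDeg, Finset.card_eq_zero, Finset.filter_eq_empty_iff]
      rintro ⟨a, b⟩ hab h
      exact ((hmem a b).mp hab).1 h
    · intro v hv
      rw [inDeg, Finset.card_eq_one]
      refine ⟨(p v, v), ?_⟩
      ext ⟨a, b⟩
      rw [Finset.mem_filter, hmem, Finset.mem_singleton, Prod.mk.injEq]
      constructor
      · rintro ⟨⟨-, rfl⟩, rfl⟩
        exact ⟨rfl, rfl⟩
      · rintro ⟨rfl, rfl⟩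
        exact ⟨⟨hv, rfl⟩, rfl⟩
    · have hirr : Std.Irrefl (Relation.TransGen (adjOf N.E)) := ⟨hacyc⟩
      have hwf : WellFounded (Relation.TransGen (adjOf N.E)) :=
        Finite.wellFounded_of_trans_of_irrefl _
      intro v
      induction v using hwf.induction with
      | _ v ih =>
        by_cases hv : v = N.root
        · rw [hv]
        · exact (ih (p v) (Relation.TransGen.single (hpE v hv))).tail ((hmem _ _).mpr ⟨hv, rfl⟩)
    · intro v hv
      by_contra hvX
      have h1 : v ∈ M.image Prod.fst := by
        rw [hfirst]
        simpa using hvX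
      obtain ⟨⟨a, b⟩, he, rfl⟩ := Finset.mem_image.mp h1
      rw [outDeg, Finset.card_eq_zero, Finset.filter_eq_empty_iff] at hv
      have hb : b ≠ N.root := by
        rintro rfl
        exact hnoroot _ (hsub he)
      exact hv ((hmem a b).mpr ⟨hb, hpM b hb a he⟩) rfl
end

section
/- A temporal binary phylogenetic network N on X is tree-based if and only if N satisfies the antichain-to-leaf property. -/
open Finset

variable {V : Type} [Fintype V] [DecidableEq V]

set_option linter.unusedSectionVars false
set_option linter.style.haveILetI false

/-- Maximal elements for reachability exist in nonempty sets of an acyclic finite digraph. -/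
lemma exists_last {E : Finset (V × V)} (hac : ∀ v : V, ¬ Relation.TransGen (adjOf E) v v)
    (P : V → Prop) (hP : ∃ v, P v) :
    ∃ w, P w ∧ ∀ w', P w' → ¬ Relation.TransGen (adjOf E) w w' := by
  let r : V → V → Prop := fun a b => Relation.TransGen (adjOf E) b a
  haveI : IsTrans V r := ⟨fun a b c h1 h2 => Relation.TransGen.trans h2 h1⟩
  haveI : Std.Irrefl r := ⟨fun a h => hac a h⟩
  have wf : WellFounded r := Finite.wellFounded_of_trans_of_irrefl r
  obtain ⟨w, hw, hmin⟩ := wf.has_min {v | P v} hP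
  exact ⟨w, hw, fun w' h' h => hmin w' h' h⟩

/-- Upward well-founded induction. -/
lemma wf_adj {E : Finset (V × V)} (hac : ∀ v : V, ¬ Relation.TransGen (adjOf E) v v) :
    WellFounded (Relation.TransGen (adjOf E)) := by
  haveI : IsTrans V (Relation.TransGen (adjOf E)) := ⟨fun a b c h1 h2 => h1.trans h2⟩
  haveI : Std.Irrefl (Relation.TransGen (adjOf E)) := ⟨fun a h => hac a h⟩
  exact Finite.wellFounded_of_trans_of_irrefl _

/-- Downward well-founded induction. -/
lemma wf_adj_swap {E : Finset (V × V)} (hac : ∀ v : V, ¬ Relation.TransGen (adjOf E) v v) :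
    WellFounded (fun a b => Relation.TransGen (adjOf E) b a) := by
  let r : V → V → Prop := fun a b => Relation.TransGen (adjOf E) b a
  haveI : IsTrans V r := ⟨fun a b c h1 h2 => Relation.TransGen.trans h2 h1⟩
  haveI : Std.Irrefl r := ⟨fun a h => hac a h⟩
  exact Finite.wellFounded_of_trans_of_irrefl r

lemma outDeg_ne_zero_iff {E : Finset (V × V)} {v : V} :
    outDeg E v ≠ 0 ↔ ∃ w, (v, w) ∈ E := by
  unfold outDeg
  rw [Finset.card_ne_zero]
  constructor
  · rintro ⟨⟨a, b⟩, h⟩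
    simp only [Finset.mem_filter] at h
    exact ⟨b, by rw [← h.2]; exact h.1⟩
  · rintro ⟨w, h⟩
    exact ⟨(v, w), by simp [h]⟩

/-- An element of a path different from its end has a successor on the path. -/
lemma path_succ {r : V → V → Prop} : ∀ (p : List V) (w x : V), List.IsChain r p → w ∈ p →
    p.getLast? = some x → w ≠ x → ∃ y ∈ p, r w y
  | [], w, x, _, h, _, _ => by simp at h
  | [a], w, x, _, h, h2, h3 => by simp_all
  | a :: b :: l, w, x, hc, h, h2, h3 => by
    rw [List.isChain_cons_cons] at hc
    by_cases hwa : w = a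
    · subst hwa
      exact ⟨b, by simp, hc.1⟩
    · have hw : w ∈ b :: l := by simpa [hwa] using h
      obtain ⟨y, hy, hr⟩ := path_succ (b :: l) w x hc.2 hw (by simpa using h2) h3
      exact ⟨y, List.mem_cons_of_mem _ hy, hr⟩

/-- The tree-based direction, from an injective choice of children. -/
lemma antichainToLeaf_of_choice (N : Network V)
    (hac : ∀ v : V, ¬ Relation.TransGen (adjOf N.E) v v)
    (g : V → V) (hg : ∀ v, v ∉ N.X → (v, g v) ∈ N.E)
    (hinj : ∀ u v, u ∉ N.X → v ∉ N.X → g u = g v → u = v) : AntichainToLeaf N := by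
  let R : V → V → Prop := fun a b => a ∉ N.X ∧ g a = b
  have hRE : ∀ a b, Relation.ReflTransGen R a b → Relation.ReflTransGen (adjOf N.E) a b := by
    intro a b h
    refine Relation.ReflTransGen.mono ?_ _ _ h
    rintro a b ⟨h1, rfl⟩
    exact hg a h1
  have hpath : ∀ v, ∃ p : List V, (IsDirPath N.E p ∧ EndsIn N.X p) ∧ p.head? = some v ∧
      ∀ w ∈ p, Relation.ReflTransGen R v w := by
    intro v
    induction v using (wf_adj_swap hac).induction with
    | _ v ih =>
      by_cases hv : v ∈ N.X
      · refine ⟨[v], ⟨⟨by simp, ?_, by simp⟩, v, hv, by simp⟩, by simp, ?_⟩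
        · exact List.IsChain.singleton v
        · intro w hw
          simp only [List.mem_singleton] at hw
          subst hw
          exact Relation.ReflTransGen.refl
      · have he : adjOf N.E v (g v) := hg v hv
        obtain ⟨p, ⟨⟨hne, hch, hnd⟩, x, hx, hlast⟩, hhead, hreach⟩ :=
          ih (g v) (Relation.TransGen.single he)
        cases p with
        | nil => exact absurd rfl hne
        | cons b l =>
          simp only [List.head?_cons, Option.some.injEq] at hhead
          subst hhead
          refine ⟨v :: g v :: l, ⟨⟨by simp, ?_, ?_⟩, x, hx, by simpa using hlast⟩, by simp, ?_⟩
          · exact List.IsChain.cons_cons he hch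
          · refine List.nodup_cons.2 ⟨fun hmem => ?_, hnd⟩
            exact hac v (Relation.TransGen.head' he (hRE _ _ (hreach v hmem)))
          · intro w hw
            rcases List.mem_cons.1 hw with rfl | hw
            · exact Relation.ReflTransGen.refl
            · exact Relation.ReflTransGen.head ⟨hv, rfl⟩ (hreach w hw)
  choose p hp hhead hreach using hpath
  have hpinj : Function.Injective p := by
    intro a b h
    have := hhead a
    rw [h, hhead b] at this
    exact (Option.some.inj this).symm
  intro S hS
  refine ⟨S.image p, Finset.card_image_of_injective _ hpinj, ?_, ?_, ?_⟩
  · intro q hq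
    obtain ⟨s, -, rfl⟩ := Finset.mem_image.1 hq
    exact hp s
  · intro q hq q' hq' hne v hv hv'
    obtain ⟨s, hs, rfl⟩ := Finset.mem_image.1 hq
    obtain ⟨t, ht, rfl⟩ := Finset.mem_image.1 hq'
    have hst : s ≠ t := fun h => hne (by rw [h])
    have h1 := Relation.ReflTransGen.swap _ _ (hreach s v hv)
    have h2 := Relation.ReflTransGen.swap _ _ (hreach t v hv')
    have hu : Relator.RightUnique (Function.swap R) := by
      rintro a b c ⟨hb, hb'⟩ ⟨hc, hc'⟩
      exact hinj b c hb hc (hb'.trans hc'.symm)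
    rcases Relation.ReflTransGen.total_of_right_unique hu h1 h2 with h | h
    · exact hS t ht s hs hst.symm (hRE _ _ (Relation.ReflTransGen.swap _ _ h))
    · exact hS s hs t ht hst (hRE _ _ (Relation.ReflTransGen.swap _ _ h))
  · intro s hs
    exact ⟨p s, Finset.mem_image_of_mem _ hs, hhead s⟩

lemma antichainToLeaf_of_treeBased (N : Network V) (hN : IsPhyloNetwork N)
    (h : TreeBased N) : AntichainToLeaf N := by
  obtain ⟨-, hac, -, -, -, -⟩ := hN
  obtain ⟨E', r, hsub, ⟨hr, hdeg, -⟩, hleaf⟩ := h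
  have hex : ∀ v, ∃ w, v ∉ N.X → (v, w) ∈ E' := by
    intro v
    by_cases hv : v ∈ N.X
    · exact ⟨v, fun h => absurd hv h⟩
    · obtain ⟨w, hw⟩ := outDeg_ne_zero_iff.1 (fun h => hv (hleaf v h))
      exact ⟨w, fun _ => hw⟩
  choose g hg using hex
  refine antichainToLeaf_of_choice N hac g (fun v hv => hsub (hg v hv)) ?_
  intro u v hu hv huv
  have h1 : inDeg E' (g u) ≤ 1 := by
    by_cases hgr : g u = r
    · rw [hgr, hr]; omega
    · rw [hdeg _ hgr]
  have := Finset.card_le_one.1 h1 (u, g u) (by simp [hg u hu]) (v, g v)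
    (by simp [hg v hv, huv])
  exact (Prod.mk.inj this).1

/-- A child-choosing injection on the non-leaves gives a spanning tree. -/
lemma treeBased_of_choice (N : Network V) (hN : IsPhyloNetwork N)
    (f : {v : V // v ∉ N.X} → V) (hf : Function.Injective f)
    (hfE : ∀ v, (v.1, f v) ∈ N.E) : TreeBased N := by
  obtain ⟨-, hac, hroot, hreach, -, -⟩ := hN
  have hnoroot : ∀ u, (u, N.root) ∉ N.E := by
    intro u hu
    unfold inDeg at hroot
    rw [Finset.card_eq_zero] at hroot
    have : (u, N.root) ∈ N.E.filter (fun e => e.2 = N.root) := by simp [hu]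
    rw [hroot] at this
    simp at this
  have hpar : ∀ v, ∃ u, v ≠ N.root → ((u, v) ∈ N.E ∧ ∀ a, f a = v → a.1 = u) := by
    intro v
    by_cases hv : v = N.root
    · exact ⟨v, fun h => absurd hv h⟩
    by_cases h : ∃ a, f a = v
    · obtain ⟨a, rfl⟩ := h
      exact ⟨a.1, fun _ => ⟨hfE a, fun b hb => by rw [hf hb]⟩⟩
    · rcases Relation.ReflTransGen.cases_tail (hreach v) with h0 | ⟨c, -, hc⟩
      · exact absurd h0 hv
      · exact ⟨c, fun _ => ⟨hc, fun a ha => absurd ⟨a, ha⟩ h⟩⟩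
  choose par hpar using hpar
  let E' : Finset (V × V) := (Finset.univ.filter (fun v => v ≠ N.root)).image (fun v => (par v, v))
  have hE' : ∀ a b, (a, b) ∈ E' ↔ b ≠ N.root ∧ a = par b := by
    intro a b
    simp only [E', Finset.mem_image, Finset.mem_filter, Finset.mem_univ, true_and, Prod.mk.injEq]
    constructor
    · rintro ⟨v, h1, h2, rfl⟩
      exact ⟨h1, h2.symm⟩
    · rintro ⟨h1, rfl⟩
      exact ⟨b, h1, rfl, rfl⟩
  refine ⟨E', N.root, ?_, ⟨?_, ?_, ?_⟩, ?_⟩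
  · rintro ⟨a, b⟩ h
    obtain ⟨h1, rfl⟩ := (hE' a b).1 h
    exact (hpar b h1).1
  · unfold inDeg
    rw [Finset.card_eq_zero, Finset.filter_eq_empty_iff]
    rintro ⟨a, b⟩ h h2
    exact ((hE' a b).1 h).1 h2
  · intro v hv
    unfold inDeg
    rw [Finset.card_eq_one]
    refine ⟨(par v, v), ?_⟩
    ext ⟨a, b⟩
    simp only [Finset.mem_filter, hE', Finset.mem_singleton, Prod.mk.injEq]
    constructor
    · rintro ⟨⟨h1, h2⟩, rfl⟩
      exact ⟨h2, rfl⟩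
    · rintro ⟨rfl, rfl⟩
      exact ⟨⟨hv, rfl⟩, rfl⟩
  · intro v
    induction v using (wf_adj hac).induction with
    | _ v ih =>
      by_cases hv : v = N.root
      · rw [hv]
      · exact Relation.ReflTransGen.tail (ih (par v) (Relation.TransGen.single (hpar v hv).1))
          ((hE' _ _).2 ⟨hv, rfl⟩)
  · intro v hv
    by_contra hX
    refine outDeg_ne_zero_iff.2 ⟨f ⟨v, hX⟩, ?_⟩ hv
    have hne : f ⟨v, hX⟩ ≠ N.root := fun h => hnoroot v (h ▸ hfE ⟨v, hX⟩)
    exact (hE' _ _).2 ⟨hne, (hpar _ hne).2 ⟨v, hX⟩ rfl⟩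

/-- Children of a vertex. -/
def chOf (E : Finset (V × V)) (v : V) : Finset V := Finset.univ.filter (fun w => (v, w) ∈ E)

lemma mem_chOf {E : Finset (V × V)} {v w : V} : w ∈ chOf E v ↔ (v, w) ∈ E := by
  simp [chOf]

/-- Hall's condition for the non-leaves. -/
lemma hall_condition (N : Network V) (hN : IsPhyloNetwork N) (hT : IsTemporal N)
    (hA : AntichainToLeaf N) (U : Finset V) (hU : ∀ u ∈ U, u ∉ N.X) :
    U.card ≤ (U.biUnion (chOf N.E)).card := by
  classical
  obtain ⟨-, hac, hroot, -, hX, hdeg⟩ := hN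
  obtain ⟨lam, hlam⟩ := hT
  induction U using Finset.strongInduction with
  | _ U ih =>
  by_contra hlt
  push Not at hlt
  set W := U.biUnion (chOf N.E) with hW
  have hmemW : ∀ w, w ∈ W ↔ ∃ u ∈ U, (u, w) ∈ N.E := by
    intro w
    simp [hW, mem_chOf]
  have hndeg : ∀ v, 2 ≤ inDeg N.E v → inDeg N.E v = 2 ∧ outDeg N.E v = 1 := by
    intro v hv
    have hvr : v ≠ N.root := by rintro rfl; omega
    rcases hdeg with h | ⟨-, h⟩
    · exact absurd (Fintype.card_le_one_iff.1 h.le v N.root) hvr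
    · have := h v hvr
      omega
  -- every vertex of W is a reticulation
  have hWret : ∀ w ∈ W, inDeg N.E w = 2 := by
    intro w hw
    obtain ⟨u, hu, huw⟩ := (hmemW w).1 hw
    have h1 := ih (U.erase u) (Finset.erase_ssubset hu)
      (fun x hx => hU x (Finset.mem_of_mem_erase hx))
    rw [Finset.card_erase_of_mem hu] at h1
    have hsub : (U.erase u).biUnion (chOf N.E) ⊆ W :=
      Finset.biUnion_subset_biUnion_of_subset_left _ (Finset.erase_subset _ _)
    have heq := Finset.eq_of_subset_of_card_le hsub (by omega)
    rw [← heq, Finset.mem_biUnion] at hw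
    obtain ⟨u', hu', hw'⟩ := hw
    have hw' := mem_chOf.1 hw'
    refine (hndeg w ?_).1
    have : 1 < inDeg N.E w := by
      unfold inDeg
      refine Finset.one_lt_card.2 ⟨(u, w), by simp [huw], (u', w), by simp [hw'], ?_⟩
      intro h
      exact (Finset.ne_of_mem_erase hu') (Prod.mk.inj h).1.symm
    omega
  have hUW : ∀ u ∈ U, ∀ w, (u, w) ∈ N.E → w ∈ W := fun u hu w h => (hmemW w).2 ⟨u, hu, h⟩
  have hlamUW : ∀ u ∈ U, ∀ w, (u, w) ∈ N.E → lam u = lam w := fun u hu w h =>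
    (hlam (u, w) h).1 (hWret w (hUW u hu w h))
  have hUne : U.Nonempty := Finset.card_pos.1 (by omega)
  obtain ⟨u0, hu0⟩ := hUne
  -- all of U lies on one level
  have hlev : ∀ u ∈ U, lam u = lam u0 := by
    by_contra hcon
    push Not at hcon
    obtain ⟨u1, hu1, hne⟩ := hcon
    have hs1 : U.filter (fun u => lam u = lam u0) ⊂ U :=
      Finset.filter_ssubset.2 ⟨u1, hu1, hne⟩
    have hs2 : U.filter (fun u => ¬ lam u = lam u0) ⊂ U :=
      Finset.filter_ssubset.2 ⟨u0, hu0, by simp⟩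
    have h1 := ih _ hs1 (fun x hx => hU x (hs1.1 hx))
    have h2 := ih _ hs2 (fun x hx => hU x (hs2.1 hx))
    have h3 := Finset.card_filter_add_card_filter_not (s := U) (fun u => lam u = lam u0)
    have hdis : Disjoint ((U.filter (fun u => lam u = lam u0)).biUnion (chOf N.E))
        ((U.filter (fun u => ¬ lam u = lam u0)).biUnion (chOf N.E)) := by
      rw [Finset.disjoint_left]
      intro w hw hw'
      simp only [Finset.mem_biUnion, Finset.mem_filter, mem_chOf] at hw hw'
      obtain ⟨a, ⟨ha, ha'⟩, haw⟩ := hw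
      obtain ⟨b, ⟨hb, hb'⟩, hbw⟩ := hw'
      exact hb' ((hlamUW b hb w hbw).trans ((hlamUW a ha w haw).symm.trans ha'))
    have h4 := Finset.card_union_of_disjoint hdis
    have h5 : ((U.filter (fun u => lam u = lam u0)).biUnion (chOf N.E)) ∪
        ((U.filter (fun u => ¬ lam u = lam u0)).biUnion (chOf N.E)) ⊆ W :=
      Finset.union_subset
        (Finset.biUnion_subset_biUnion_of_subset_left _ (Finset.filter_subset _ _))
        (Finset.biUnion_subset_biUnion_of_subset_left _ (Finset.filter_subset _ _))
    have h6 := Finset.card_le_card h5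
    omega
  have hlevW : ∀ w ∈ W, lam w = lam u0 := by
    intro w hw
    obtain ⟨u, hu, huw⟩ := (hmemW w).1 hw
    rw [← hlamUW u hu w huw, hlev u hu]
  have hmono : ∀ a b, Relation.ReflTransGen (adjOf N.E) a b → lam a ≤ lam b := by
    intro a b h
    induction h with
    | refl => exact le_rfl
    | @tail b c _ hbc ih =>
      refine ih.trans ?_
      by_cases h2 : inDeg N.E c = 2
      · exact ((hlam (b, c) hbc).1 h2).le
      · exact ((hlam (b, c) hbc).2 h2).le
  -- forced moves along reticulations
  let R : V → V → Prop := fun a b => adjOf N.E a b ∧ inDeg N.E a = 2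
  have hRu : Relator.RightUnique R := by
    rintro a b c ⟨hb, ha⟩ ⟨hc, -⟩
    have h1 : outDeg N.E a ≤ 1 := (hndeg a ha.ge).2.le
    have := Finset.card_le_one.1 h1 (a, b) (Finset.mem_filter.2 ⟨hb, rfl⟩) (a, c) (Finset.mem_filter.2 ⟨hc, rfl⟩)
    exact (Prod.mk.inj this).2
  have hforced : ∀ w d, Relation.ReflTransGen (adjOf N.E) w d → inDeg N.E w = 2 →
      lam w = lam d → Relation.ReflTransGen R w d ∧ inDeg N.E d = 2 := by
    intro w d h hw
    induction h with
    | refl => exact fun _ => ⟨Relation.ReflTransGen.refl, hw⟩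
    | @tail b c hwb hbc ih =>
      intro hl
      have h1 := hmono _ _ hwb
      have h2 := hmono b c (Relation.ReflTransGen.single hbc)
      have h3 : lam w = lam b := le_antisymm h1 (hl ▸ h2)
      obtain ⟨h4, h5⟩ := ih h3
      refine ⟨h4.tail ⟨hbc, h5⟩, ?_⟩
      by_contra h6
      have h7 := (hlam (b, c) hbc).2 h6
      simp only at h7
      linarith
  have hRE : ∀ a b, Relation.ReflTransGen R a b → Relation.ReflTransGen (adjOf N.E) a b :=
    fun a b h => Relation.ReflTransGen.mono (fun _ _ (h : R _ _) => h.1) _ _ h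
  have hXout : ∀ x, x ∈ N.X → ∀ y, (x, y) ∉ N.E := by
    intro x hx y hxy
    rw [hX] at hx
    exact outDeg_ne_zero_iff.2 ⟨y, hxy⟩ (by simpa using hx)
  have hXout' : ∀ x, x ∉ N.X → ∃ y, (x, y) ∈ N.E := by
    intro x hx
    rw [hX] at hx
    exact outDeg_ne_zero_iff.1 (by simpa using hx)
  -- the top elements of U
  let S := U.filter (fun s => ∀ u ∈ U, ¬ Relation.TransGen (adjOf N.E) u s)
  have hSanti : IsDigraphAntichain N.E S := by
    intro u hu v hv huv h
    rcases Relation.reflTransGen_iff_eq_or_transGen.1 h with h | h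
    · exact huv h.symm
    · exact (Finset.mem_filter.1 hv).2 u (Finset.mem_filter.1 hu).1 h
  obtain ⟨P, -, hPpath, hPdis, hPhead⟩ := hA S hSanti
  choose! p hpP hphead using hPhead
  -- successor on a path in P
  have hsucc : ∀ q ∈ P, ∀ w ∈ q, (∃ y, (w, y) ∈ N.E) → ∃ y ∈ q, (w, y) ∈ N.E := by
    intro q hq w hw ⟨y, hy⟩
    obtain ⟨⟨-, hc, -⟩, x, hx, hl⟩ := hPpath q hq
    refine path_succ q w x hc hw hl ?_
    rintro rfl
    exact hXout _ hx y hy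
  have hfollow : ∀ q ∈ P, ∀ w d, Relation.ReflTransGen R w d → w ∈ q → d ∈ q := by
    intro q hq w d h hw
    induction h with
    | refl => exact hw
    | @tail b c _ hbc ih =>
      obtain ⟨y, hy, hby⟩ := hsucc q hq b ih ⟨c, hbc.1⟩
      have : y = c := hRu ⟨hby, hbc.2⟩ hbc
      exact this ▸ hy
  have hexS : ∀ s ∈ S, ∃ w, (w ∈ W ∧ w ∈ p s) ∧
      ∀ w', (w' ∈ W ∧ w' ∈ p s) → ¬ Relation.TransGen (adjOf N.E) w w' := by
    intro s hs
    refine exists_last hac _ ?_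
    have hsU := (Finset.mem_filter.1 hs).1
    obtain ⟨y, hy, hsy⟩ := hsucc (p s) (hpP s hs) s (List.mem_of_mem_head? (hphead s hs))
      (hXout' s (hU s hsU))
    exact ⟨y, hUW s hsU y hsy, hy⟩
  have hexD : ∀ d, d ∈ U ∧ d ∉ S → ∃ w, (w ∈ W ∧ Relation.ReflTransGen (adjOf N.E) w d) ∧
      ∀ w', (w' ∈ W ∧ Relation.ReflTransGen (adjOf N.E) w' d) →
        ¬ Relation.TransGen (adjOf N.E) w w' := by
    rintro d ⟨hd, hdS⟩
    refine exists_last hac _ ?_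
    have : ∃ u ∈ U, Relation.TransGen (adjOf N.E) u d := by
      by_contra hcon
      push Not at hcon
      exact hdS (Finset.mem_filter.2 ⟨hd, hcon⟩)
    obtain ⟨u, hu, hud⟩ := this
    obtain ⟨w, huw, hwd⟩ := Relation.TransGen.head'_iff.1 hud
    exact ⟨w, hUW u hu w huw, hwd⟩
  choose! hs hs1 hs2 using hexS
  choose! hd hd1 hd2 using hexD
  have hDR : ∀ d, d ∈ U ∧ d ∉ S → Relation.ReflTransGen R (hd d) d := by
    intro d h
    have h1 := hd1 d h
    exact (hforced _ _ h1.2 (hWret _ h1.1) ((hlevW _ h1.1).trans (hlev d h.1).symm)).1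
  have hSD : ∀ s ∈ S, ∀ d, d ∈ U ∧ d ∉ S → hs s ≠ hd d := by
    intro s hsS d hdD heq
    have hR := hDR d hdD
    have hmem := hfollow (p s) (hpP s hsS) _ d hR (heq ▸ (hs1 s hsS).2)
    obtain ⟨y, hy, hdy⟩ := hsucc (p s) (hpP s hsS) d hmem (hXout' d (hU d hdD.1))
    refine hs2 s hsS y ⟨hUW d hdD.1 y hdy, hy⟩ ?_
    rw [heq]
    exact Relation.TransGen.tail' (hRE _ _ hR) hdy
  have hDD : ∀ d d', d ∈ U ∧ d ∉ S → d' ∈ U ∧ d' ∉ S → hd d = hd d' →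
      Relation.ReflTransGen R d d' → d = d' := by
    intro d d' h h' heq hR
    rcases Relation.ReflTransGen.cases_head hR with h0 | ⟨y, hdy, hyd⟩
    · exact h0
    · exfalso
      refine hd2 d' h' y ⟨hUW d h.1 y hdy.1, hRE _ _ hyd⟩ ?_
      rw [← heq]
      exact Relation.TransGen.tail' (hRE _ _ (hDR d h)) hdy.1
  let h : V → V := fun u => if u ∈ S then hs u else hd u
  have hcard : U.card ≤ W.card := by
    refine Finset.card_le_card_of_injOn h ?_ ?_
    · intro u hu
      by_cases huS : u ∈ S
      · simpa [h, huS] using (hs1 u huS).1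
      · simpa [h, huS] using (hd1 u ⟨hu, huS⟩).1
    · intro a ha b hb hab
      by_cases haS : a ∈ S <;> by_cases hbS : b ∈ S <;> simp only [h, haS, hbS, if_true, if_false] at hab
      · by_contra hne
        refine hPdis (p a) (hpP a haS) (p b) (hpP b hbS) ?_ (hs a) (hs1 a haS).2 ?_
        · intro hpe
          have h1 := hphead a haS
          rw [hpe, hphead b hbS] at h1
          exact hne (Option.some.inj h1).symm
        · rw [hab]; exact (hs1 b hbS).2
      · exact absurd hab (hSD a haS b ⟨hb, hbS⟩)
      · exact absurd hab.symm (hSD b hbS a ⟨ha, haS⟩)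
      · have r1 := hDR a ⟨ha, haS⟩
        have r2 := hDR b ⟨hb, hbS⟩
        rw [← hab] at r2
        rcases Relation.ReflTransGen.total_of_right_unique hRu r1 r2 with h1 | h1
        · exact hDD a b ⟨ha, haS⟩ ⟨hb, hbS⟩ hab h1
        · exact (hDD b a ⟨hb, hbS⟩ ⟨ha, haS⟩ hab.symm h1).symm
  omega

lemma treeBased_of_antichainToLeaf (N : Network V) (hN : IsPhyloNetwork N) (hT : IsTemporal N)
    (hA : AntichainToLeaf N) : TreeBased N := by
  classical
  have hall := (Finset.all_card_le_biUnion_card_iff_exists_injective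
    (fun v : {v : V // v ∉ N.X} => chOf N.E v.1)).1 (by
      intro s
      have h1 := hall_condition N hN hT hA (s.map (Function.Embedding.subtype _)) (by
        intro u hu
        obtain ⟨a, -, rfl⟩ := Finset.mem_map.1 hu
        exact a.2)
      rw [Finset.card_map] at h1
      refine h1.trans (Finset.card_le_card ?_)
      intro w hw
      simp only [Finset.mem_biUnion, Finset.mem_map] at hw ⊢
      obtain ⟨_, ⟨a, ha, rfl⟩, hw⟩ := hw
      exact ⟨a, ha, hw⟩)
  obtain ⟨f, hf, hfc⟩ := hall
  exact treeBased_of_choice N hN f hf (fun v => mem_chOf.1 (hfc v))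

/-- A temporal binary phylogenetic network `N` on `X` is tree-based
iff `N` satisfies the antichain-to-leaf property. -/
theorem stmt_11 {V : Type} [Fintype V] [DecidableEq V] (N : Network V)
    (hN : IsPhyloNetwork N) (hT : IsTemporal N) :
    TreeBased N ↔ AntichainToLeaf N := by
  exact ⟨antichainToLeaf_of_treeBased N hN, treeBased_of_antichainToLeaf N hN hT⟩
end

section
/- Every tree-based binary phylogenetic network N on X satisfies the antichain-to-leaf property: for every antichain of k vertices of N there exist k pairwise vertex-disjoint directed paths from the elements of the antichain to leaves of N. -/
open Finset

variable {V : Type} [Fintype V] [DecidableEq V]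

lemma aux_linear {V : Type} {g : V → V → Prop} (hg : ∀ a b c, g a c → g b c → a = b)
    {s t v : V} (hs : Relation.ReflTransGen g s v) (ht : Relation.ReflTransGen g t v) :
    Relation.ReflTransGen g s t ∨ Relation.ReflTransGen g t s := by
  induction hs with
  | refl => exact Or.inr ht
  | tail hsb hbc ih =>
    rcases Relation.ReflTransGen.cases_tail ht with h | ⟨d, htd, hdc⟩
    · subst h
      exact Or.inl (hsb.tail hbc)
    · have := hg _ _ _ hdc hbc
      subst this
      exact ih htd

lemma aux_inj {V : Type} [DecidableEq V] {E : Finset (V × V)} {r : V}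
    (h0 : inDeg E r = 0) (h1 : ∀ v : V, v ≠ r → inDeg E v = 1) (a b c : V)
    (ha : (a, c) ∈ E) (hb : (b, c) ∈ E) : a = b := by
  have hle : inDeg E c ≤ 1 := by
    by_cases hc : c = r
    · subst hc; omega
    · exact (h1 c hc).le
  have := Finset.card_le_one.mp hle (a, c) (by simp [ha]) (b, c) (by simp [hb])
  simpa using congrArg Prod.fst this

/-- Every vertex starts a path along the functional relation `g`, ending in `X`. -/
lemma aux_path {V : Type} [Finite V] (X : Finset V) (g : V → V → Prop)
    (hac : ∀ v, ¬ Relation.TransGen g v v) (hs : ∀ v, v ∉ X → ∃ w, g v w) (v : V) :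
    ∃ p : List V, p.head? = some v ∧ List.IsChain g p ∧ p.Nodup ∧ EndsIn X p ∧
      ∀ w ∈ p, Relation.ReflTransGen g v w := by
  have wf : WellFounded (fun a b => Relation.TransGen g b a) := by
    have : IsTrans V (fun a b => Relation.TransGen g b a) := ⟨fun a b c h1 h2 => h2.trans h1⟩
    have : Std.Irrefl (fun a b : V => Relation.TransGen g b a) := ⟨hac⟩
    exact Finite.wellFounded_of_trans_of_irrefl _
  induction v using wf.induction with
  | _ v ih =>
    by_cases hv : v ∈ X
    · exact ⟨[v], rfl, by simp, by simp, ⟨v, hv, rfl⟩, by simp [Relation.ReflTransGen.refl]⟩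
    · obtain ⟨w, hw⟩ := hs v hv
      obtain ⟨p, hp, hc, hn, ⟨x, hx, hl⟩, hr⟩ := ih w (Relation.TransGen.single hw)
      refine ⟨v :: p, rfl, ?_, ?_, ⟨x, hx, ?_⟩, ?_⟩
      · rw [List.isChain_cons]
        refine ⟨?_, hc⟩
        intro y hy
        rw [hp] at hy
        simp at hy
        exact hy ▸ hw
      · refine List.nodup_cons.mpr ⟨fun hm => ?_, hn⟩
        exact hac v (Relation.TransGen.head' hw (hr v hm))
      · rw [List.getLast?_cons, hl]; rfl
      · intro y hy
        rcases List.mem_cons.mp hy with rfl | hy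
        · exact Relation.ReflTransGen.refl
        · exact Relation.ReflTransGen.head hw (hr y hy)

/-- Every tree-based binary phylogenetic network `N` on `X`
satisfies the antichain-to-leaf property. -/
theorem stmt_12 {V : Type} [Fintype V] [DecidableEq V] (N : Network V)
    (hN : IsPhyloNetwork N) (h : TreeBased N) :
    AntichainToLeaf N := by
  obtain ⟨-, hac, -⟩ := hN
  obtain ⟨E', r, hE, ⟨h0, h1, -⟩, hX⟩ := h
  have hex : ∀ v, ∃ w, v ∉ N.X → (v, w) ∈ E' := by
    intro v
    by_cases hv : v ∈ N.X
    · exact ⟨v, fun h => absurd hv h⟩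
    · have hne : outDeg E' v ≠ 0 := fun h => hv (hX v h)
      obtain ⟨⟨a, b⟩, he⟩ := Finset.card_pos.mp (Nat.pos_of_ne_zero hne)
      obtain ⟨he2, rfl⟩ := Finset.mem_filter.mp he
      exact ⟨b, fun _ => he2⟩
  choose f hf using hex
  let g : V → V → Prop := fun a b => a ∉ N.X ∧ f a = b
  have hgE' : ∀ a b, g a b → (a, b) ∈ E' := by
    rintro a b ⟨ha, rfl⟩
    exact hf a ha
  have hgE : ∀ a b, g a b → adjOf N.E a b := fun a b hab => hE (hgE' a b hab)
  have hgi : ∀ a b c, g a c → g b c → a = b := fun a b c ha hb =>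
    aux_inj h0 h1 a b c (hgE' _ _ ha) (hgE' _ _ hb)
  have hgac : ∀ v, ¬ Relation.TransGen g v v := fun v hv => hac v (Relation.TransGen.mono hgE _ _ hv)
  choose path hhead hchain hnd hend hreach using
    aux_path N.X g hgac (fun v hv => ⟨f v, hv, rfl⟩)
  intro S hS
  have hinj : Function.Injective path := by
    intro a b hab
    have := hhead a
    rw [hab, hhead b] at this
    exact (Option.some.inj this).symm
  refine ⟨S.image path, Finset.card_image_of_injective _ hinj, ?_, ?_, ?_⟩
  · intro p hp
    obtain ⟨s, -, rfl⟩ := Finset.mem_image.mp hp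
    refine ⟨⟨?_, (hchain s).imp hgE, hnd s⟩, hend s⟩
    intro hnil
    have := hhead s
    rw [hnil] at this
    simp at this
  · intro p hp q hq hpq v hvp hvq
    obtain ⟨s, hs, rfl⟩ := Finset.mem_image.mp hp
    obtain ⟨t, ht, rfl⟩ := Finset.mem_image.mp hq
    have hst : s ≠ t := fun h => hpq (h ▸ rfl)
    rcases aux_linear hgi (hreach s v hvp) (hreach t v hvq) with h | h
    · exact hS s hs t ht hst (Relation.ReflTransGen.mono hgE _ _ h)
    · exact hS t ht s hs hst.symm (Relation.ReflTransGen.mono hgE _ _ h)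
  · intro s hs
    exact ⟨path s, Finset.mem_image_of_mem _ hs, hhead s⟩
end

section
/- Let T be a subdivision of a rooted binary tree with vertex set V. Then for every non-empty subset U of V there exists a set of pairwise vertex-disjoint directed paths in T, each of which ends at a leaf of T, such that each vertex of U lies on exactly one of these paths. -/
open Finset

variable {V : Type} [Fintype V] [DecidableEq V]

theorem aux_pred_unique {V : Type} [DecidableEq V] {E : Finset (V × V)} {r : V}
    (h0 : inDeg E r = 0) (h1 : ∀ v : V, v ≠ r → inDeg E v = 1) {a b c : V}
    (ha : (a, c) ∈ E) (hb : (b, c) ∈ E) : a = b := by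
  have hle : (E.filter fun e => e.2 = c).card ≤ 1 := by
    by_cases hc : c = r
    · subst hc
      unfold inDeg at h0
      omega
    · exact (h1 c hc).le
  have := Finset.card_le_one.mp hle (a, c) (by simp [ha]) (b, c) (by simp [hb])
  simpa using this

theorem aux_acyclic {V : Type} [DecidableEq V] {E : Finset (V × V)} {r : V}
    (h0 : inDeg E r = 0) (h1 : ∀ v : V, v ≠ r → inDeg E v = 1)
    (h2 : ∀ v : V, Relation.ReflTransGen (adjOf E) r v) (v : V) :
    ¬ Relation.TransGen (adjOf E) v v := by
  induction h2 v with
  | refl =>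
    intro h
    obtain ⟨c, -, hc⟩ := Relation.TransGen.tail'_iff.mp h
    have hm : (c, r) ∈ E.filter fun e => e.2 = r := Finset.mem_filter.mpr ⟨hc, rfl⟩
    exact Finset.card_ne_zero_of_mem hm h0
  | @tail a b _ hab ih =>
    intro h
    obtain ⟨c, hbc, hc⟩ := Relation.TransGen.tail'_iff.mp h
    have : c = a := aux_pred_unique h0 h1 hc hab
    subst this
    exact ih (Relation.TransGen.head' hab hbc)

theorem aux_path_s13 {V : Type} [Fintype V] [DecidableEq V] {E : Finset (V × V)}
    (hac : ∀ v : V, ¬ Relation.TransGen (adjOf E) v v)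
    (M : V → V → Prop) (hM : ∀ a b, M a b → (a, b) ∈ E)
    (hfun : ∀ a b c, M a b → M a c → b = c)
    (hex : ∀ a, outDeg E a ≠ 0 → ∃ b, M a b) (v : V) :
    ∃ p : List V, p.head? = some v ∧ IsDirPath E p ∧
      (∃ x : V, p.getLast? = some x ∧ outDeg E x = 0) ∧
      ∀ w, w ∈ p ↔ Relation.ReflTransGen M v w := by
  have hwf : WellFounded (fun a b : V => Relation.TransGen (adjOf E) b a) := by
    haveI : IsTrans V (fun a b : V => Relation.TransGen (adjOf E) b a) :=
      ⟨fun a b c h h' => h'.trans h⟩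
    haveI : Std.Irrefl (fun a b : V => Relation.TransGen (adjOf E) b a) := ⟨hac⟩
    exact Finite.wellFounded_of_trans_of_irrefl _
  induction v using hwf.induction with
  | _ v ih =>
    by_cases hv : outDeg E v = 0
    · refine ⟨[v], rfl, ⟨List.cons_ne_nil _ _, List.isChain_singleton _, List.nodup_singleton _⟩, ⟨v, rfl, hv⟩, ?_⟩
      intro w
      rw [List.mem_singleton]
      constructor
      · rintro rfl
        exact Relation.ReflTransGen.refl
      · intro h
        rcases h.cases_head with h | ⟨c, hc, -⟩
        · exact h.symm
        · have hm : (v, c) ∈ E.filter fun e => e.1 = v :=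
            Finset.mem_filter.mpr ⟨hM _ _ hc, rfl⟩
          exact absurd hv (Finset.card_ne_zero_of_mem hm)
    · obtain ⟨c, hc⟩ := hex v hv
      have hvc : adjOf E v c := hM _ _ hc
      obtain ⟨p, hh, ⟨hne, hch, hnd⟩, ⟨x, hx, hx0⟩, hmem⟩ := ih c (Relation.TransGen.single hvc)
      refine ⟨v :: p, rfl, ⟨by simp, ?_, ?_⟩, ⟨x, ?_, hx0⟩, ?_⟩
      · refine List.isChain_cons.mpr ⟨?_, hch⟩
        intro y hy
        rw [hh] at hy
        simp at hy
        exact hy ▸ hvc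
      · refine List.nodup_cons.mpr ⟨fun h => ?_, hnd⟩
        have h' := (hmem v).mp h
        exact hac v (Relation.TransGen.head' hvc (Relation.ReflTransGen.mono hM _ _ h'))
      · rw [List.getLast?_cons, hx]; rfl
      · intro w
        rw [List.mem_cons, hmem]
        constructor
        · rintro (rfl | h)
          · exact Relation.ReflTransGen.refl
          · exact Relation.ReflTransGen.head hc h
        · intro h
          rcases h.cases_head with h | ⟨d, hd, h⟩
          · exact Or.inl h.symm
          · rw [hfun _ _ _ hc hd]
            exact Or.inr h

theorem aux_head_unique {V : Type} (M : V → V → Prop)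
    (hinj : ∀ a b c, M a c → M b c → a = b) {h h' v : V}
    (hh : ∀ w, ¬ M w h) (hh' : ∀ w, ¬ M w h')
    (h1 : Relation.ReflTransGen M h v) (h2 : Relation.ReflTransGen M h' v) : h = h' := by
  induction h1 with
  | refl =>
    rcases h2.cases_tail with e | ⟨c, -, hc⟩
    · exact e
    · exact absurd hc (hh c)
  | @tail a b _ hab ih =>
    rcases h2.cases_tail with e | ⟨c, hc', hc⟩
    · subst e
      exact absurd hab (hh' a)
    · rw [hinj _ _ _ hc hab] at hc'
      exact ih hc'

/-- If `T = (V, E)` is a subdivision of a rooted binary tree, then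
for every non-empty `U ⊆ V` there is a set of pairwise vertex-disjoint directed
paths in `T`, each ending at a leaf of `T` (a vertex of out-degree 0), such that
each vertex of `U` lies on exactly one of the paths. -/
theorem stmt_13 {V : Type} [Fintype V] [DecidableEq V]
    (E : Finset (V × V)) (r : V) (hT : IsSubdividedRootedBinaryTree E r)
    (U : Finset V) (hU : U.Nonempty) :
    ∃ P : Finset (List V),
      (∀ p ∈ P, IsDirPath E p ∧ ∃ x : V, p.getLast? = some x ∧ outDeg E x = 0) ∧
      PairwiseDisjointPaths P ∧
      ∀ u ∈ U, ∃! p, p ∈ P ∧ u ∈ p := by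
  classical
  obtain ⟨⟨h0, h1, h2⟩, -, -⟩ := hT
  have hac := aux_acyclic h0 h1 h2
  have hch : ∀ a : V, ∃ b, outDeg E a ≠ 0 → (a, b) ∈ E := by
    intro a
    by_cases ha : outDeg E a = 0
    · exact ⟨a, fun h => absurd ha h⟩
    · obtain ⟨⟨x, y⟩, he⟩ := Finset.card_pos.mp (Nat.pos_of_ne_zero ha)
      obtain ⟨hxy, hx⟩ := Finset.mem_filter.mp he
      simp only at hx
      subst hx
      exact ⟨y, fun _ => hxy⟩
  choose f hf using hch
  let M : V → V → Prop := fun a b => outDeg E a ≠ 0 ∧ f a = b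
  have hM : ∀ a b, M a b → (a, b) ∈ E := by
    rintro a b ⟨ha, rfl⟩
    exact hf a ha
  have hinj : ∀ a b c, M a c → M b c → a = b := fun a b c ha hb =>
    aux_pred_unique h0 h1 (hM _ _ ha) (hM _ _ hb)
  have hpath := aux_path_s13 hac M hM (fun a b c h h' => h.2.symm.trans h'.2)
    (fun a ha => ⟨f a, ha, rfl⟩)
  choose path _ hdir hleaf hmem using hpath
  have hcov : ∀ v : V, ∃ h, (∀ w, ¬ M w h) ∧ Relation.ReflTransGen M h v := by
    intro v
    induction h2 v with
    | refl =>
      refine ⟨r, fun w hw => ?_, Relation.ReflTransGen.refl⟩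
      have hm : (w, r) ∈ E.filter fun e => e.2 = r := Finset.mem_filter.mpr ⟨hM _ _ hw, rfl⟩
      exact Finset.card_ne_zero_of_mem hm h0
    | @tail a b _ hab ih =>
      by_cases hb : ∀ w, ¬ M w b
      · exact ⟨b, hb, Relation.ReflTransGen.refl⟩
      · push Not at hb
        obtain ⟨w, hw⟩ := hb
        obtain ⟨h, hh, hr⟩ := ih
        have : w = a := aux_pred_unique h0 h1 (hM _ _ hw) hab
        subst this
        exact ⟨h, hh, hr.tail hw⟩
  have huniq : ∀ h h' v, (∀ w, ¬ M w h) → (∀ w, ¬ M w h') → v ∈ path h → v ∈ path h' →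
      h = h' := fun h h' v hh hh' hv hv' =>
    aux_head_unique M hinj hh hh' ((hmem _ _).mp hv) ((hmem _ _).mp hv')
  refine ⟨(Finset.univ.filter fun h => ∀ w, ¬ M w h).image path, ?_, ?_, ?_⟩
  · intro p hp
    obtain ⟨h, -, rfl⟩ := Finset.mem_image.mp hp
    exact ⟨hdir h, hleaf h⟩
  · intro p hp q hq hpq v hvp hvq
    obtain ⟨h, hh, rfl⟩ := Finset.mem_image.mp hp
    obtain ⟨h', hh', rfl⟩ := Finset.mem_image.mp hq
    exact hpq (congrArg path (huniq h h' v (Finset.mem_filter.mp hh).2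
      (Finset.mem_filter.mp hh').2 hvp hvq))
  · intro u _
    obtain ⟨h, hh, hr⟩ := hcov u
    refine ⟨path h, ⟨Finset.mem_image.mpr ⟨h, by simpa using hh, rfl⟩, (hmem _ _).mpr hr⟩, ?_⟩
    rintro q ⟨hq, huq⟩
    obtain ⟨h', hh', rfl⟩ := Finset.mem_image.mp hq
    exact congrArg path (huniq h' h u (Finset.mem_filter.mp hh').2 hh huq ((hmem _ _).mpr hr))
end
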